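/- arXiv:2211.03678 — 2 statements merged into one kernel-verified Lean document; each statement's English description precedes it below -/
import Mathlib

section
/- Let A be an n × n matrix with complex entries and let m ≥ 0 be an integer. Then the trace of the m-th exterior power of A (the induced linear endomorphism of ⋀^m ℂ^n) equals Σ_{μ} (1/Z_μ) · (−1)^{m + ℓ(μ)} · Π_{j=1}^{ℓ(μ)} tr(A^{m_j}), where the sum is over all partitions μ = (m_1, …, m_t) of m, ℓ(μ) = t is the number of parts of μ, and Z_μ = Π_{k≥1} k^{μ(k)} · μ(k)! with μ(k) the number of parts of μ equal to k. -/
noncomputable section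

open scoped BigOperators

theorem exteriorAlgebra_map_mem (R M : Type) [CommRing R] [AddCommGroup M] [Module R M]
    (m : ℕ) (f : M →ₗ[R] M) : ∀ x ∈ ⋀[R]^m M, ExteriorAlgebra.map f x ∈ ⋀[R]^m M := by
  intro x hx
  have h : Submodule.map (ExteriorAlgebra.map f).toLinearMap (⋀[R]^m M) ≤ ⋀[R]^m M := by
    rw [Submodule.map_pow]
    refine pow_le_pow_left' ?_ m
    rw [ExteriorAlgebra.ι_range_map_map]
    exact Submodule.map_le_iff_le_comap.mpr fun y hy => LinearMap.mem_range_self _ _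
  exact h (Submodule.mem_map_of_mem hx)

/-- The endomorphism of the `m`-th exterior power `⋀^m M` induced by `f : M →ₗ M`. -/
def extPowMap (R M : Type) [CommRing R] [AddCommGroup M] [Module R M] (m : ℕ)
    (f : M →ₗ[R] M) : (⋀[R]^m M) →ₗ[R] (⋀[R]^m M) :=
  (ExteriorAlgebra.map f).toLinearMap.restrict (exteriorAlgebra_map_mem R M m f)

/-- Every endomorphism of a finite-dimensional vector space over an algebraically closed field is
lower triangular in some basis. -/
theorem exists_basis_isLowerTriangular {K : Type*} [Field K] [IsAlgClosed K] (n : ℕ) :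
    ∀ {V : Type*} [AddCommGroup V] [Module K V] [FiniteDimensional K V],
      Module.finrank K V = n → ∀ f : V →ₗ[K] V,
      ∃ b : Module.Basis (Fin n) K V, (LinearMap.toMatrix b b f).IsLowerTriangular := by
  induction n with
  | zero =>
    intro V _ _ _ hV f
    exact ⟨Module.finBasisOfFinrankEq K V hV, fun i => i.elim0⟩
  | succ n ih =>
    intro V _ _ _ hV f
    have : Nontrivial V := Module.nontrivial_of_finrank_pos (R := K) (by omega)
    obtain ⟨c, hc⟩ := Module.End.exists_eigenvalue (K := K) f.dualMap
    obtain ⟨φ, hφ⟩ := hc.exists_hasEigenvector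
    have hφf (x : V) : φ (f x) = c * φ x := LinearMap.congr_fun hφ.apply_eq_smul x
    have hmem : ∀ x ∈ LinearMap.ker φ, f x ∈ LinearMap.ker φ := by
      intro x hx
      rw [LinearMap.mem_ker] at hx ⊢
      rw [hφf, hx, mul_zero]
    have hker := Module.Dual.finrank_ker_add_one_of_ne_zero hφ.2
    obtain ⟨w, hw⟩ := ih (V := LinearMap.ker φ) (by omega) (f.restrict hmem)
    obtain ⟨y, hy⟩ : ∃ y, φ y ≠ 0 := by
      by_contra! h
      exact hφ.2 (LinearMap.ext h)
    let b := Module.Basis.mkFinCons y w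
      (by
        intro a x hx h
        have := congrArg φ h
        rw [map_add, map_smul, LinearMap.mem_ker.mp hx, add_zero, smul_eq_mul, map_zero] at this
        exact (mul_eq_zero.mp this).resolve_right hy)
      (by
        intro z
        refine ⟨-(φ z / φ y), ?_⟩
        rw [LinearMap.mem_ker, map_add, map_smul, smul_eq_mul]
        field_simp
        ring)
    have hbs (i : Fin n) : b i.succ = w i := by simp [b]
    have hfb (j : Fin n) :
        f (b j.succ) = ∑ i, LinearMap.toMatrix w w (f.restrict hmem) i j • b i.succ := by
      have := congrArg Subtype.val (w.sum_repr (f.restrict hmem (w j)))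
      simp only [hbs, LinearMap.toMatrix_apply]
      rw [← LinearMap.coe_restrict_apply hmem (w j), ← this]
      simp only [AddSubmonoidClass.coe_finsetSum, Submodule.coe_smul]
    refine ⟨b, fun i j hij => ?_⟩
    replace hij : i < j := hij
    obtain ⟨j, rfl⟩ := Fin.exists_succ_eq.mpr (Fin.ne_zero_of_lt hij)
    rw [LinearMap.toMatrix_apply, hfb]
    simp only [map_sum, map_smul, Module.Basis.repr_self, Finsupp.coe_finsetSum, Finset.sum_apply,
      Finsupp.smul_apply, smul_eq_mul]
    refine Finset.sum_eq_zero fun k _ => ?_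
    rw [Finsupp.single_apply]
    split_ifs with h
    · subst h
      rw [hw (show OrderDual.toDual j < OrderDual.toDual k from Fin.succ_lt_succ_iff.mp hij),
        zero_mul]
    · rw [mul_zero]

theorem Matrix.IsLowerTriangular.mul_apply_self {ι R : Type*} [Fintype ι] [LinearOrder ι]
    [CommRing R] {M N : Matrix ι ι R} (hM : M.IsLowerTriangular)
    (hN : N.IsLowerTriangular) (i : ι) : (M * N) i i = M i i * N i i := by
  rw [Matrix.mul_apply]
  refine Finset.sum_eq_single i (fun k _ hk => ?_) (by simp)
  rcases lt_or_gt_of_ne hk with h | h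
  · rw [hN h, mul_zero]
  · rw [hM h, zero_mul]

theorem Matrix.IsLowerTriangular.pow_apply_self {ι R : Type*} [Fintype ι] [LinearOrder ι]
    [CommRing R] {M : Matrix ι ι R} (hM : M.IsLowerTriangular) (p : ℕ) (i : ι) :
    (M ^ p) i i = M i i ^ p := by
  induction p with
  | zero => simp
  | succ p ih => rw [pow_succ, pow_succ, Matrix.IsLowerTriangular.mul_apply_self (hM.pow p) hM, ih]

/-- The trace of an exterior power of a triangular endomorphism is an elementary symmetric function
of its diagonal entries. -/
theorem trace_exteriorPower_map_eq_sum {ι R M : Type*} [Fintype ι] [LinearOrder ι] [CommRing R]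
    [AddCommGroup M] [Module R M] (m : ℕ) (f : M →ₗ[R] M) (b : Module.Basis ι R M)
    (hb : (LinearMap.toMatrix b b f).IsLowerTriangular) :
    LinearMap.trace R (⋀[R]^m M) (exteriorPower.map m f) =
      ∑ s ∈ Finset.powersetCard m Finset.univ, ∏ i ∈ s, LinearMap.toMatrix b b f i i := by
  rw [LinearMap.trace_eq_matrix_trace R (b.exteriorPower m), Matrix.trace]
  rw [← Finset.sum_coe_sort (Finset.powersetCard m (Finset.univ : Finset ι))]
  let e : Set.powersetCard ι m ≃ Finset.powersetCard m (Finset.univ : Finset ι) :=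
    Equiv.subtypeEquivRight fun s => by simp [Finset.mem_powersetCard]
  refine Fintype.sum_equiv e _ _ fun s => ?_
  rw [Matrix.diag_apply, LinearMap.toMatrix_apply, exteriorPower.basis_apply,
    exteriorPower.map_apply_ιMulti_family, exteriorPower.basis_repr_apply,
    exteriorPower.ιMulti_family, exteriorPower.ιMultiDual_apply_ιMulti,
    Matrix.det_of_isUpperTriangular]
  · change ∏ i, _ = ∏ i ∈ s.val, _
    rw [← Finset.image_orderEmbOfFin_univ s.val s.prop,
      Finset.prod_image (Finset.orderEmbOfFin s.val s.prop).injective.injOn]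
    simp [LinearMap.toMatrix_apply, Set.powersetCard.ofFinEmbEquiv_symm_apply]
  · intro i j hij
    simpa [LinearMap.toMatrix_apply] using
      hb (i := Set.powersetCard.ofFinEmbEquiv.symm s j)
        (j := Set.powersetCard.ofFinEmbEquiv.symm s i)
        (OrderDual.toDual_lt_toDual.mpr ((OrderEmbedding.lt_iff_lt _).mpr hij))

theorem trace_pow_eq_sum_pow {ι R M : Type*} [Fintype ι] [LinearOrder ι] [CommRing R]
    [AddCommGroup M] [Module R M] (f : M →ₗ[R] M) (b : Module.Basis ι R M)
    (hb : (LinearMap.toMatrix b b f).IsLowerTriangular) (p : ℕ) :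
    LinearMap.trace R M (f ^ p) = ∑ i, LinearMap.toMatrix b b f i i ^ p := by
  rw [LinearMap.trace_eq_matrix_trace R b, ← LinearMap.toMatrix_pow, Matrix.trace]
  exact Finset.sum_congr rfl fun i _ => hb.pow_apply_self p i

/-- The multisets of positive integers with sum `m`. -/
def partitionParts (m : ℕ) : Finset (Multiset ℕ) :=
  (Finset.univ : Finset (Nat.Partition m)).image Nat.Partition.parts

theorem mem_partitionParts {m : ℕ} {s : Multiset ℕ} :
    s ∈ partitionParts m ↔ (∀ i ∈ s, 0 < i) ∧ s.sum = m := by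
  simp only [partitionParts, Finset.mem_image, Finset.mem_univ, true_and]
  constructor
  · rintro ⟨μ, rfl⟩
    exact ⟨fun _ => μ.parts_pos, μ.parts_sum⟩
  · rintro ⟨h, hs⟩
    exact ⟨⟨s, fun {i} => h i, hs⟩, rfl⟩

theorem sum_partitionParts {R : Type*} [AddCommMonoid R] (m : ℕ) (F : Multiset ℕ → R) :
    ∑ s ∈ partitionParts m, F s = ∑ μ : Nat.Partition m, F μ.parts :=
  Finset.sum_image fun _ _ _ _ h => Nat.Partition.ext h

/-- The product of `k ^ c * c!` over the elements `k` of `s`, where `c` is the multiplicity of `k`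
in `s`. -/
def multiplicityFactor (s : Multiset ℕ) : ℕ :=
  ∏ k ∈ s.toFinset, k ^ s.count k * (s.count k).factorial

theorem prod_eq_multiplicityFactor {s : Multiset ℕ} {t : Finset ℕ} (h : s.toFinset ⊆ t) :
    ∏ k ∈ t, k ^ s.count k * (s.count k).factorial = multiplicityFactor s := by
  refine (Finset.prod_subset h fun k _ hk => ?_).symm
  rw [Multiset.mem_toFinset] at hk
  simp [Multiset.count_eq_zero_of_notMem hk]

theorem multiplicityFactor_cons (k : ℕ) (s : Multiset ℕ) :
    multiplicityFactor (k ::ₘ s) = k * (s.count k + 1) * multiplicityFactor s := by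
  have hs : s.toFinset ⊆ insert k s.toFinset := Finset.subset_insert _ _
  rw [← prod_eq_multiplicityFactor hs, multiplicityFactor, Multiset.toFinset_cons,
    ← Finset.mul_prod_erase _ _ (Finset.mem_insert_self _ _),
    ← Finset.mul_prod_erase (insert k s.toFinset) (fun k => k ^ s.count k * _)
      (Finset.mem_insert_self _ _), Multiset.count_cons_self, pow_succ, Nat.factorial_succ,
    Finset.prod_congr rfl fun j hj => by
      rw [Multiset.count_cons_of_ne (Finset.ne_of_mem_erase hj)]]
  ring

/-- The summand attached to the partition `s` in the expansion of an elementary symmetric function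
in power sums `p`. -/
def partitionWeight {K : Type*} [Field K] (p : ℕ → K) (s : Multiset ℕ) : K :=
  (multiplicityFactor s : K)⁻¹ * (s.map fun k => (-1) ^ (k + 1) * p k).prod

theorem count_mul_partitionWeight_cons {K : Type*} [Field K] [CharZero K] (p : ℕ → K) {k : ℕ}
    (hk : k ≠ 0) (s : Multiset ℕ) :
    ((k ::ₘ s).count k * k : ℕ) * partitionWeight p (k ::ₘ s) =
      (-1) ^ (k + 1) * p k * partitionWeight p s := by
  rw [partitionWeight, partitionWeight, multiplicityFactor_cons, Multiset.count_cons_self,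
    Multiset.map_cons, Multiset.prod_cons]
  have h : (k : K) ≠ 0 := Nat.cast_ne_zero.mpr hk
  have h' : ((s.count k : K) + 1) ≠ 0 := Nat.cast_add_one_ne_zero _
  push_cast
  rw [mul_inv]
  field_simp

theorem mul_sum_partitionWeight {K : Type*} [Field K] [CharZero K] (p : ℕ → K) (m : ℕ) :
    m * ∑ s ∈ partitionParts m, partitionWeight p s =
      ∑ a ∈ Finset.HasAntidiagonal.antidiagonal m with a.1 < m,
        (-1) ^ (a.2 + 1) * p a.2 * ∑ s ∈ partitionParts a.1, partitionWeight p s := by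
  have hm : ∀ s ∈ partitionParts m, (m : K) * partitionWeight p s =
      ∑ k ∈ s.toFinset, ((s.count k * k : ℕ) : K) * partitionWeight p s := by
    intro s hs
    rw [← Finset.sum_mul, ← Nat.cast_sum]
    congr 2
    rw [← (mem_partitionParts.mp hs).2, Finset.sum_multiset_count]
    simp
  simp_rw [Finset.mul_sum]
  rw [Finset.sum_congr rfl hm, Finset.sum_sigma', Finset.sum_sigma']
  refine Finset.sum_bij' (fun x _ => ⟨(m - x.2, x.2), x.1.erase x.2⟩)
    (fun x _ => ⟨x.1.2 ::ₘ x.2, x.1.2⟩) ?_ ?_ ?_ ?_ ?_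
  · rintro ⟨s, k⟩ h
    simp only [Finset.mem_sigma, Multiset.mem_toFinset, mem_partitionParts, Finset.mem_filter,
      Finset.HasAntidiagonal.mem_antidiagonal] at h ⊢
    obtain ⟨⟨hpos, hsum⟩, hk⟩ := h
    have := Multiset.sum_erase hk
    have := hpos k hk
    exact ⟨by omega, fun i hi => hpos i (Multiset.mem_of_mem_erase hi), by omega⟩
  · rintro ⟨⟨a, k⟩, s⟩ h
    simp only [Finset.mem_sigma, Multiset.mem_toFinset, mem_partitionParts, Finset.mem_filter,
      Finset.HasAntidiagonal.mem_antidiagonal, Multiset.mem_cons, Multiset.sum_cons, true_or, and_true] at h ⊢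
    refine ⟨?_, by omega⟩
    rintro i (rfl | hi)
    · omega
    · exact h.2.1 i hi
  · rintro ⟨s, k⟩ h
    simp only [Finset.mem_sigma, Multiset.mem_toFinset] at h
    simp [Multiset.cons_erase h.2]
  · rintro ⟨⟨a, k⟩, s⟩ h
    simp only [Finset.mem_sigma, Finset.mem_filter, Finset.HasAntidiagonal.mem_antidiagonal] at h
    simp [← h.1.1]
  · rintro ⟨s, k⟩ h
    simp only [Finset.mem_sigma, Multiset.mem_toFinset, mem_partitionParts] at h
    have := count_mul_partitionWeight_cons p (h.1.1 k h.2).ne' (s.erase k)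
    rwa [Multiset.cons_erase h.2] at this

/-- The expansion of elementary symmetric functions in power sums. -/
theorem sum_powersetCard_prod_eq_sum_partitionWeight {K ι : Type*} [Field K] [CharZero K]
    [Fintype ι] (d : ι → K) (m : ℕ) :
    ∑ s ∈ Finset.powersetCard m Finset.univ, ∏ i ∈ s, d i =
      ∑ s ∈ partitionParts m, partitionWeight (fun k => ∑ i, d i ^ k) s := by
  induction m using Nat.strong_induction_on with
  | _ m ih =>
    rcases eq_or_ne m 0 with rfl | hm
    · rw [sum_partitionParts]
      simp [partitionWeight, multiplicityFactor]
    · have newton := congrArg (MvPolynomial.aeval d) (MvPolynomial.mul_esymm_eq_sum ι K m)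
      simp only [map_mul, map_natCast, map_pow, map_neg, map_one, map_sum, MvPolynomial.esymm,
        MvPolynomial.psum, map_prod, MvPolynomial.aeval_X] at newton
      refine mul_left_cancel₀ (Nat.cast_ne_zero.mpr hm : (m : K) ≠ 0) ?_
      rw [newton, mul_sum_partitionWeight, Finset.mul_sum]
      refine Finset.sum_congr rfl fun a ha => ?_
      rw [Finset.mem_filter, Finset.HasAntidiagonal.mem_antidiagonal] at ha
      rw [ih a.1 ha.2, ← ha.1, show a.1 + a.2 + 1 = a.1 + (a.2 + 1) by ring, pow_add (-1 : K) a.1]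
      have : (-1 : K) ^ a.1 * (-1) ^ a.1 = 1 := by rw [← mul_pow]; simp
      linear_combination ((-1 : K) ^ (a.2 + 1) * (∑ i, d i ^ a.2) *
        ∑ s ∈ partitionParts a.1, partitionWeight (fun k => ∑ i, d i ^ k) s) * this

theorem partitionWeight_parts {K : Type*} [Field K] (p : ℕ → K) {m : ℕ} (μ : Nat.Partition m) :
    partitionWeight p μ.parts =
      ((∏ k ∈ Finset.Icc 1 m,
          k ^ (μ.parts.count k) * (μ.parts.count k).factorial : ℕ) : K)⁻¹ *
        (-1 : K) ^ (m + Multiset.card μ.parts) * (μ.parts.map p).prod := by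
  have hsub : μ.parts.toFinset ⊆ Finset.Icc 1 m := fun k hk => by
    rw [Multiset.mem_toFinset] at hk
    exact Finset.mem_Icc.mpr ⟨μ.parts_pos hk, μ.le_of_mem_parts hk⟩
  have hsign (s : Multiset ℕ) :
      (s.map fun k => (-1 : K) ^ (k + 1)).prod = (-1) ^ (s.sum + Multiset.card s) := by
    induction s using Multiset.induction_on with
    | empty => simp
    | cons k s ih => simp only [Multiset.map_cons, Multiset.prod_cons, ih, Multiset.sum_cons,
        Multiset.card_cons]; ring
  rw [prod_eq_multiplicityFactor hsub, partitionWeight, Multiset.prod_map_mul, hsign,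
    μ.parts_sum, mul_assoc]

theorem extPowMap_eq_map {R M : Type} [CommRing R] [AddCommGroup M] [Module R M] (m : ℕ)
    (f : M →ₗ[R] M) : extPowMap R M m f = exteriorPower.map m f := by
  refine exteriorPower.linearMap_ext (AlternatingMap.ext fun v => Subtype.ext ?_)
  simp only [LinearMap.compAlternatingMap_apply, exteriorPower.map_apply_ιMulti]
  exact ExteriorAlgebra.map_apply_ιMulti f v

/-- the trace of the `m`-th exterior power of an `n × n` complex matrix `A`
equals `Σ_{μ ⊢ m} (1/Z_μ) (-1)^{m+ℓ(μ)} Π_j tr(A^{m_j})`. -/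
theorem trace_exteriorPower_eq_partition_sum (n m : ℕ) (A : Matrix (Fin n) (Fin n) ℂ) :
    LinearMap.trace ℂ (⋀[ℂ]^m (Fin n → ℂ)) (extPowMap ℂ (Fin n → ℂ) m A.mulVecLin) =
      ∑ μ : Nat.Partition m,
        ((∏ k ∈ Finset.Icc 1 m,
            k ^ (μ.parts.count k) * (μ.parts.count k).factorial : ℕ) : ℂ)⁻¹ *
          (-1 : ℂ) ^ (m + Multiset.card μ.parts) *
          (μ.parts.map (fun p => Matrix.trace (A ^ p))).prod := by
  obtain ⟨b, hb⟩ := exists_basis_isLowerTriangular n (by simp) A.mulVecLin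
  have htrace (p : ℕ) : Matrix.trace (A ^ p) =
      ∑ i, LinearMap.toMatrix b b A.mulVecLin i i ^ p := by
    rw [← trace_pow_eq_sum_pow _ b hb, ← Matrix.toLin'_apply', ← Matrix.toLin'_pow,
      Matrix.trace_toLin'_eq]
  rw [extPowMap_eq_map, trace_exteriorPower_map_eq_sum m _ b hb,
    sum_powersetCard_prod_eq_sum_partitionWeight, sum_partitionParts]
  simp_rw [partitionWeight_parts, htrace]
end
end

section
/- Let F be a finite field with q elements and n ≥ 1. The number of isomorphism classes of irreducible finite-dimensional complex representations π of GL_n(F) that are generic — i.e., for a (equivalently, any) nontrivial additive character ψ of F there exists a nonzero linear functional ℓ on the space of π with ℓ(π(u)v) = ψ(u)·ℓ(v) for all upper unitriangular u ∈ U_n and all vectors v, where ψ(u) := ψ(u_{1,2} + u_{2,3} + ⋯ + u_{n−1,n}) — equals q^n − q^{n−1}. -/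
noncomputable section

open scoped BigOperators

/-- The predicate of being an upper unitriangular matrix. -/
def IsUnipUpper {F : Type} [Field F] {N : ℕ} (u : Matrix (Fin N) (Fin N) F) : Prop :=
  (∀ i, u i i = 1) ∧ ∀ i j : Fin N, (j : ℕ) < (i : ℕ) → u i j = 0

/-- The extension of an additive character `ψ` to (unitriangular) matrices:
`u ↦ ψ (u 1 2 + u 2 3 + ⋯)`. -/
def psiU {F : Type} [Field F] (ψ : AddChar F ℂ) {N : ℕ} (u : Matrix (Fin N) (Fin N) F) : ℂ :=
  ψ (∑ i : Fin (N - 1),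
      u ⟨(i : ℕ), lt_of_lt_of_le i.isLt (Nat.sub_le N 1)⟩
        ⟨(i : ℕ) + 1, by have := i.isLt; omega⟩)

/-- A finite-dimensional complex (matrix) representation of `GL_N(F)`. -/
structure FinRep (N : ℕ) (F : Type) [Field F] where
  d : ℕ
  ρ : (Matrix (Fin N) (Fin N) F)ˣ →* (Matrix (Fin d) (Fin d) ℂ)ˣ

/-- Irreducibility: the space is nonzero and has no nontrivial invariant subspace. -/
def FinRep.Irreducible {N : ℕ} {F : Type} [Field F] (π : FinRep N F) : Prop :=
  0 < π.d ∧ ∀ W : Submodule ℂ (Fin π.d → ℂ),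
    (∀ g : (Matrix (Fin N) (Fin N) F)ˣ, ∀ v ∈ W,
        ((π.ρ g : Matrix (Fin π.d) (Fin π.d) ℂ)).mulVec v ∈ W) →
      W = ⊥ ∨ W = ⊤

/-- Genericity: there is a nonzero `ψ`-Whittaker functional. -/
def FinRep.Generic {N : ℕ} {F : Type} [Field F] (ψ : AddChar F ℂ) (π : FinRep N F) : Prop :=
  ∃ ℓ : (Fin π.d → ℂ) →ₗ[ℂ] ℂ, ℓ ≠ 0 ∧
    ∀ u : (Matrix (Fin N) (Fin N) F)ˣ, IsUnipUpper (u : Matrix (Fin N) (Fin N) F) →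
      ∀ v : Fin π.d → ℂ,
        ℓ (((π.ρ u : Matrix (Fin π.d) (Fin π.d) ℂ)).mulVec v) =
          psiU ψ (u : Matrix (Fin N) (Fin N) F) * ℓ v

/-- Isomorphism of two such representations. -/
def FinRep.Iso {N : ℕ} {F : Type} [Field F] (π σ : FinRep N F) : Prop :=
  ∃ e : (Fin π.d → ℂ) ≃ₗ[ℂ] (Fin σ.d → ℂ),
    ∀ (g : (Matrix (Fin N) (Fin N) F)ˣ) (v : Fin π.d → ℂ),
      e (((π.ρ g : Matrix (Fin π.d) (Fin π.d) ℂ)).mulVec v) =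
        ((σ.ρ g : Matrix (Fin σ.d) (Fin σ.d) ℂ)).mulVec (e v)

open scoped Classical in
/-- The set `U_N` of upper unitriangular matrices. -/
def unipFinset (F : Type) [Field F] [Fintype F] (N : ℕ) :
    Finset (Matrix (Fin N) (Fin N) F) :=
  Finset.univ.filter IsUnipUpper

open scoped Classical in
/-- The trace character of `π`, extended by zero to all matrices. -/
def traceChar {F : Type} [Field F] {N : ℕ} (π : FinRep N F) (A : Matrix (Fin N) (Fin N) F) : ℂ :=
  if h : IsUnit A then Matrix.trace ((π.ρ h.unit : Matrix (Fin π.d) (Fin π.d) ℂ)) else 0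

/-- The normalized Bessel function of `π` (S. I. Gelfand's formula), extended by zero to
all matrices. -/
def Bessel {F : Type} [Field F] [Fintype F] {N : ℕ}
    (ψ : AddChar F ℂ) (π : FinRep N F) (A : Matrix (Fin N) (Fin N) F) : ℂ :=
  ((unipFinset F N).card : ℂ)⁻¹ *
    ∑ u ∈ unipFinset F N, (psiU ψ u)⁻¹ * traceChar π (A * u)

/-- The `N × N` block matrix with `a·I_{N-M}` in the upper-right corner, an `M × M` matrix `h`
in the lower-left corner, and zero blocks elsewhere. -/
def cornerBlock (F : Type) [Field F] (N M : ℕ) (a : F) (h : Matrix (Fin M) (Fin M) F) :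
    Matrix (Fin N) (Fin N) F :=
  fun i j =>
    if (i : ℕ) < N - M then (if (j : ℕ) = (i : ℕ) + M then a else 0)
    else if hi : (i : ℕ) - (N - M) < M then
      (if hj : (j : ℕ) < M then h ⟨(i : ℕ) - (N - M), hi⟩ ⟨(j : ℕ), hj⟩ else 0)
    else 0

end

section PiMatrix

variable {ι : Type} [Fintype ι] [DecidableEq ι] {d : ι → ℕ}

/-- The subspace `e A e` of an algebra `A`. -/
def cornerSubmodule {A : Type} [Ring A] [Algebra ℂ A] (e : A) : Submodule ℂ A :=
  LinearMap.range (LinearMap.mulLeftRight ℂ (e, e))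

lemma mem_cornerSubmodule {A : Type} [Ring A] [Algebra ℂ A] {e x : A} :
    x ∈ cornerSubmodule e ↔ ∃ y, e * y * e = x := by
  simp [cornerSubmodule, LinearMap.mem_range, LinearMap.mulLeftRight_apply]

lemma exists_matrix_mulVec_eq {m : ℕ} {x : Fin m → ℂ} (hx : x ≠ 0) (y : Fin m → ℂ) :
    ∃ M : Matrix (Fin m) (Fin m) ℂ, M.mulVec x = y := by
  obtain ⟨l, hl⟩ := Function.ne_iff.mp hx
  refine ⟨Matrix.vecMulVec y (Pi.single l (x l)⁻¹), ?_⟩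
  ext i
  have hl' : x l ≠ 0 := hl
  simp [Matrix.mulVec, Matrix.vecMulVec, dotProduct, Pi.single_apply, hl']

lemma submodule_eq_bot_or_top_of_matrix_invariant {m : ℕ} (W : Submodule ℂ (Fin m → ℂ))
    (hW : ∀ M : Matrix (Fin m) (Fin m) ℂ, ∀ v ∈ W, M.mulVec v ∈ W) : W = ⊥ ∨ W = ⊤ := by
  by_cases h : W = ⊥
  · exact Or.inl h
  · right
    obtain ⟨x, hxW, hx⟩ := W.ne_bot_iff.mp h
    refine eq_top_iff.mpr fun y _ => ?_
    obtain ⟨M, rfl⟩ := exists_matrix_mulVec_eq hx y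
    exact hW M x hxW

lemma exists_component_of_irreducible {D : ℕ}
    (f : (Π i, Matrix (Fin (d i)) (Fin (d i)) ℂ) →ₐ[ℂ] Matrix (Fin D) (Fin D) ℂ) (hD : 0 < D)
    (hf : ∀ W : Submodule ℂ (Fin D → ℂ), (∀ b, ∀ v ∈ W, (f b).mulVec v ∈ W) → W = ⊥ ∨ W = ⊤) :
    ∃ i, ∃ e : (Fin D → ℂ) ≃ₗ[ℂ] (Fin (d i) → ℂ),
      ∀ b v, e ((f b).mulVec v) = (b i).mulVec (e v) := by
  have h1 : ∃ i k, f (Pi.single i (Matrix.single k k 1)) ≠ 0 := by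
    by_contra! h
    have h0 : f 1 = 0 := by
      have : (1 : Π i, Matrix (Fin (d i)) (Fin (d i)) ℂ)
          = ∑ i, ∑ k, Pi.single i (Matrix.single k k 1) := by
        funext i
        rw [Finset.sum_apply, Finset.sum_eq_single i]
        · simp only [Finset.sum_apply, Pi.single_eq_same, Pi.one_apply]
          exact (Matrix.sum_single_one).symm
        · intro j _ hj
          simp [Finset.sum_apply, Pi.single_eq_of_ne (Ne.symm hj)]
        · simp
      rw [this]
      simp [map_sum, h]
    rw [map_one] at h0
    have := congrFun (congrFun h0 ⟨0, hD⟩) ⟨0, hD⟩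
    simp at this
  obtain ⟨i, k, hik⟩ := h1
  obtain ⟨v0, hv0⟩ : ∃ v0, (f (Pi.single i (Matrix.single k k 1))).mulVec v0 ≠ 0 := by
    by_contra! h
    exact hik (Matrix.ext_of_mulVec_single fun j => by rw [h]; ext; simp)
  let L : (Fin (d i) → ℂ) →ₗ[ℂ] (Fin D → ℂ) :=
    { toFun := fun x => (f (Pi.single i (Matrix.vecMulVec x (Pi.single k 1)))).mulVec v0
      map_add' := fun x y => by
        rw [Matrix.add_vecMulVec, Pi.single_add, map_add, Matrix.add_mulVec]
      map_smul' := fun c x => by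
        rw [Matrix.smul_vecMulVec, Pi.single_smul, map_smul, Matrix.smul_mulVec]; rfl }
  have hLdef : ∀ x, L x = (f (Pi.single i (Matrix.vecMulVec x (Pi.single k 1)))).mulVec v0 :=
    fun _ => rfl
  have hL : ∀ b x, L ((b i).mulVec x) = (f b).mulVec (L x) := by
    intro b x
    rw [hLdef, hLdef, Matrix.mulVec_mulVec, ← map_mul]
    congr 2
    funext j
    by_cases hj : j = i
    · subst hj
      simp [Matrix.mul_vecMulVec]
    · simp [Pi.single_eq_of_ne hj]
  have hL0 : L (Pi.single k 1) ≠ 0 := by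
    rw [hLdef, ← Matrix.single_eq_single_vecMulVec_single]
    exact hv0
  have hinj : LinearMap.ker L = ⊥ := by
    rw [LinearMap.ker_eq_bot']
    intro x hx
    by_contra hx0
    obtain ⟨M, hM⟩ := exists_matrix_mulVec_eq hx0 (Pi.single k 1)
    apply hL0
    have := hL (Pi.single i M) x
    rw [Pi.single_eq_same, hM, hx, Matrix.mulVec_zero] at this
    exact this
  have hsurj : LinearMap.range L = ⊤ := by
    refine (hf (LinearMap.range L) ?_).resolve_left ?_
    · rintro b _ ⟨x, rfl⟩
      exact ⟨_, hL b x⟩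
    · intro h
      exact hL0 (by simpa [h] using LinearMap.mem_range_self L (Pi.single k 1))
  let e := LinearEquiv.ofBijective L ⟨LinearMap.ker_eq_bot.mp hinj, LinearMap.range_eq_top.mp hsurj⟩
  refine ⟨i, e.symm, fun b v => ?_⟩
  rw [LinearEquiv.symm_apply_eq]
  change _ = L _
  rw [hL]
  congr 1
  exact (e.apply_symm_apply v).symm

/-- In a matrix algebra, a nonzero idempotent with commutative corner has a one-dimensional
corner. -/
lemma exists_smul_of_commute_corner {m : ℕ} {P : Matrix (Fin m) (Fin m) ℂ} (hP : P * P = P)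
    (hP0 : P ≠ 0) (hc : ∀ x y, (P * x * P) * (P * y * P) = (P * y * P) * (P * x * P))
    (x : Matrix (Fin m) (Fin m) ℂ) : ∃ c : ℂ, P * x * P = c • P := by
  obtain ⟨l, b, hlb⟩ : ∃ l b, P l b ≠ 0 := by
    by_contra! h
    exact hP0 (Matrix.ext h)
  set X := P * x * P with hX
  have hXP : X * P = X := by rw [hX, mul_assoc, hP]
  have hPX : P * X = X := by rw [hX, ← mul_assoc, ← mul_assoc, hP]
  refine ⟨X l b / P l b, ?_⟩
  ext a k
  have h := hc x (Matrix.single k l 1)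
  rw [← hX] at h
  have h1 : X * Matrix.single k l 1 * P = P * Matrix.single k l 1 * X := by
    calc X * Matrix.single k l 1 * P = X * (P * Matrix.single k l 1 * P) := by
          rw [← mul_assoc, ← mul_assoc, hXP]
      _ = _ := by rw [h, mul_assoc, mul_assoc, mul_assoc, hPX]
  have h2 := congrFun (congrFun h1 a) b
  have key : ∀ A B : Matrix (Fin m) (Fin m) ℂ,
      (A * Matrix.single k l (1 : ℂ) * B : Matrix (Fin m) (Fin m) ℂ) a b = A a k * B l b := by
    intro A B
    rw [Matrix.single_eq_single_vecMulVec_single, Matrix.mul_vecMulVec, Matrix.vecMulVec_mul]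
    simp [Matrix.vecMulVec_apply]
  rw [key, key] at h2
  rw [Matrix.smul_apply, smul_eq_mul]
  field_simp
  linear_combination h2

lemma finrank_corner_eq_card {A : Type} [Ring A] [Algebra ℂ A]
    (Φ : A ≃ₐ[ℂ] Π i, Matrix (Fin (d i)) (Fin (d i)) ℂ) {e : A} (he : e * e = e)
    (hc : ∀ x ∈ cornerSubmodule e, ∀ y ∈ cornerSubmodule e, x * y = y * x) :
    Nat.card {i // Φ e i ≠ 0} = Module.finrank ℂ (cornerSubmodule e) := by
  classical
  let b : {i // Φ e i ≠ 0} → A := fun i => Φ.symm (Pi.single i.1 (Φ e i.1))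
  have hΦb : ∀ i, Φ (b i) = Pi.single i.1 (Φ e i.1) := fun i => Φ.apply_symm_apply _
  have hli : LinearIndependent ℂ b := by
    rw [Fintype.linearIndependent_iff]
    intro g hg i
    have := congrFun (congrArg Φ hg) i.1
    rw [map_sum, Finset.sum_apply, Finset.sum_eq_single i] at this
    · rw [map_smul, hΦb, Pi.smul_apply, Pi.single_eq_same, map_zero, Pi.zero_apply] at this
      exact (smul_eq_zero.mp this).resolve_right i.2
    · intro j _ hj
      rw [map_smul, hΦb, Pi.smul_apply,
        Pi.single_eq_of_ne (fun h => hj (Subtype.ext h.symm)), smul_zero]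
    · simp
  have hei : ∀ i, Φ e i * Φ e i = Φ e i := fun i => by
    rw [← Pi.mul_apply, ← map_mul, he]
  have hspan : Submodule.span ℂ (Set.range b) = cornerSubmodule e := by
    apply le_antisymm
    · rw [Submodule.span_le]
      rintro _ ⟨i, rfl⟩
      rw [SetLike.mem_coe, mem_cornerSubmodule]
      refine ⟨b i, Φ.injective ?_⟩
      rw [map_mul, map_mul, hΦb]
      funext j
      by_cases hj : j = i.1
      · subst hj
        simp [hei]
      · simp [Pi.single_eq_of_ne hj]
    · intro x hx
      obtain ⟨y, rfl⟩ := mem_cornerSubmodule.mp hx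
      have hcomp : ∀ i : {i // Φ e i ≠ 0}, ∃ c : ℂ, Φ e i * Φ y i * Φ e i = c • Φ e i := by
        intro i
        refine exists_smul_of_commute_corner (hei i) i.2 (fun p q => ?_) _
        have h := hc _ (mem_cornerSubmodule.mpr ⟨Φ.symm (Pi.single i.1 p), rfl⟩)
          _ (mem_cornerSubmodule.mpr ⟨Φ.symm (Pi.single i.1 q), rfl⟩)
        simpa using congrFun (congrArg Φ h) i.1
      choose c hcc using hcomp
      have : e * y * e = ∑ i, c i • b i := by
        apply Φ.injective
        funext j
        rw [map_sum, Finset.sum_apply]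
        simp only [map_smul, hΦb, map_mul, Pi.mul_apply, Pi.smul_apply]
        by_cases hj : Φ e j = 0
        · rw [Finset.sum_eq_zero]
          · simp [hj]
          · intro i _
            by_cases hij : j = i.1
            · exact absurd hj (hij ▸ i.2)
            · rw [Pi.single_eq_of_ne hij, smul_zero]
        · rw [Finset.sum_eq_single ⟨j, hj⟩]
          · rw [hcc ⟨j, hj⟩]; simp
          · intro i _ hi
            rw [Pi.single_eq_of_ne (fun h => hi (Subtype.ext h.symm)), smul_zero]
          · simp
      rw [this]
      exact Submodule.sum_mem _ fun i _ => Submodule.smul_mem _ _ (Submodule.subset_span ⟨i, rfl⟩)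
  rw [← hspan, finrank_span_eq_card hli, Nat.card_eq_fintype_card]

end PiMatrix

section Hecke

open MonoidAlgebra

variable {G : Type} [Group G] {U : Subgroup G} {χ : U →* ℂ}

lemma char_inv_mul_self (u : U) : χ u⁻¹ * χ u = 1 := by
  rw [← map_mul, inv_mul_cancel, map_one]

lemma char_mul_inv_self (u : U) : χ u * χ u⁻¹ = 1 := by
  rw [← map_mul, mul_inv_cancel, map_one]

variable [Fintype G]

open scoped Classical in
/-- The idempotent of `ℂ[G]` attached to a linear character of a subgroup. -/
noncomputable def charIdempotent (U : Subgroup G) (χ : U →* ℂ) : MonoidAlgebra ℂ G :=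
  (Fintype.card U : ℂ)⁻¹ • ∑ u : U, χ u⁻¹ • of ℂ G (u : G)

lemma of_mul_charIdempotent (u : U) :
    of ℂ G (u : G) * charIdempotent U χ = χ u • charIdempotent U χ := by
  classical
  rw [charIdempotent, mul_smul_comm, smul_comm (χ u)]
  congr 1
  rw [Finset.mul_sum, Finset.smul_sum]
  refine Fintype.sum_equiv (Equiv.mulLeft u) (fun v : U => of ℂ G (u : G) * χ v⁻¹ • of ℂ G (v : G))
    (fun v : U => χ u • χ v⁻¹ • of ℂ G (v : G)) fun v => ?_
  have h : χ u * χ (u * v)⁻¹ = χ v⁻¹ := by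
    rw [mul_inv_rev, map_mul, mul_left_comm, char_mul_inv_self, mul_one]
  rw [mul_smul_comm, ← map_mul, smul_smul, Equiv.coe_mulLeft, h]
  rfl

lemma charIdempotent_mul_of (u : U) :
    charIdempotent U χ * of ℂ G (u : G) = χ u • charIdempotent U χ := by
  classical
  rw [charIdempotent, smul_mul_assoc, smul_comm (χ u)]
  congr 1
  rw [Finset.sum_mul, Finset.smul_sum]
  refine Fintype.sum_equiv (Equiv.mulRight u) (fun v : U => χ v⁻¹ • of ℂ G (v : G) * of ℂ G (u : G))
    (fun v : U => χ u • χ v⁻¹ • of ℂ G (v : G)) fun v => ?_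
  have h : χ u * χ (v * u)⁻¹ = χ v⁻¹ := by
    rw [mul_inv_rev, map_mul, ← mul_assoc, char_mul_inv_self, one_mul]
  rw [smul_mul_assoc, ← map_mul, smul_smul, Equiv.coe_mulRight, h]
  rfl

lemma charIdempotent_mul_self :
    charIdempotent U χ * charIdempotent U χ = charIdempotent U χ := by
  classical
  conv_lhs => enter [1]; rw [charIdempotent]
  rw [smul_mul_assoc, Finset.sum_mul]
  simp only [smul_mul_assoc, of_mul_charIdempotent, smul_smul, char_inv_mul_self, one_smul]
  rw [Finset.sum_const, Finset.card_univ, ← Nat.cast_smul_eq_nsmul ℂ, smul_smul,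
    inv_mul_cancel₀ (Nat.cast_ne_zero.mpr Fintype.card_ne_zero), one_smul]

/-- The element `e g e` of the Hecke algebra, where `e` is the idempotent of a character. -/
noncomputable def heckeElement (U : Subgroup G) (χ : U →* ℂ) (g : G) : MonoidAlgebra ℂ G :=
  charIdempotent U χ * of ℂ G g * charIdempotent U χ

lemma heckeElement_mul_mul (u v : U) (g : G) :
    heckeElement U χ (u * g * v) = (χ u * χ v) • heckeElement U χ g := by
  rw [heckeElement, map_mul, map_mul]
  calc _ = (charIdempotent U χ * of ℂ G (u : G)) * of ℂ G g
        * (of ℂ G (v : G) * charIdempotent U χ) := by simp only [mul_assoc]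
    _ = _ := by
      rw [charIdempotent_mul_of, of_mul_charIdempotent, smul_mul_assoc, smul_mul_assoc,
        mul_smul_comm, smul_smul, heckeElement]

lemma heckeElement_eq_zero {g : G} {u v : U} (h : (u : G) * g * v = g) (hne : χ u * χ v ≠ 1) :
    heckeElement U χ g = 0 := by
  have h1 := heckeElement_mul_mul (χ := χ) u v g
  rw [h] at h1
  have h2 : (χ u * χ v - 1) • heckeElement U χ g = 0 := by
    rw [sub_smul, one_smul, ← h1, sub_self]
  exact (smul_eq_zero.mp h2).resolve_left (sub_ne_zero.mpr hne)

open scoped Classical in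
lemma coeff_heckeElement (g x : G) :
    (heckeElement U χ g).coeff x = ((Fintype.card U : ℂ)⁻¹ * (Fintype.card U : ℂ)⁻¹) *
      ∑ u : U, ∑ v : U, if (u : G) * g * v = x then χ u⁻¹ * χ v⁻¹ else 0 := by
  rw [heckeElement, charIdempotent, smul_mul_assoc, smul_mul_assoc, mul_smul_comm, smul_smul,
    Finset.sum_mul, Finset.sum_mul]
  simp only [Finset.mul_sum, smul_mul_assoc, mul_smul_comm, smul_smul, ← map_mul]
  simp [Finsupp.single_apply, Finset.mul_sum, mul_comm, mul_assoc]
  refine Finset.sum_congr rfl fun u _ => Finset.sum_congr rfl fun v _ => ?_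
  split_ifs <;> rfl

lemma coeff_heckeElement_of_not_mem {g x : G} (h : ∀ u v : U, (u : G) * g * v ≠ x) :
    (heckeElement U χ g).coeff x = 0 := by
  classical
  rw [coeff_heckeElement, Finset.sum_eq_zero, mul_zero]
  intro u _
  exact Finset.sum_eq_zero fun v _ => if_neg (h u v)

lemma coeff_heckeElement_self_ne_zero {g : G}
    (h : ∀ u v : U, (u : G) * g * v = g → χ u * χ v = 1) :
    (heckeElement U χ g).coeff g ≠ 0 := by
  classical
  have hcard : (Fintype.card U : ℂ) ≠ 0 := Nat.cast_ne_zero.mpr Fintype.card_ne_zero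
  rw [coeff_heckeElement]
  refine mul_ne_zero (mul_ne_zero (inv_ne_zero hcard) (inv_ne_zero hcard)) ?_
  have h1 : ∀ u v : U, (if (u : G) * g * v = g then χ u⁻¹ * χ v⁻¹ else 0)
      = (((if (u : G) * g * v = g then 1 else 0 : ℕ)) : ℂ) := by
    intro u v
    split_ifs with huv
    · have h2 := h u v huv
      rw [Nat.cast_one]
      calc χ u⁻¹ * χ v⁻¹ = (χ u⁻¹ * χ v⁻¹) * (χ u * χ v) := by rw [h2, mul_one]
        _ = (χ u⁻¹ * χ u) * (χ v⁻¹ * χ v) := by ring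
        _ = 1 := by rw [char_inv_mul_self, char_inv_mul_self, one_mul]
    · simp
  simp only [h1, ← Nat.cast_sum]
  rw [Nat.cast_ne_zero]
  intro h0
  rw [Finset.sum_eq_zero_iff] at h0
  have := (Finset.sum_eq_zero_iff.mp (h0 1 (Finset.mem_univ _))) 1 (Finset.mem_univ _)
  simp at this

variable {κ : Type} (m : κ → G)

lemma linearIndependent_heckeElement
    (hdisj : ∀ i j, ∀ u v : U, (u : G) * m i * v = m j → i = j)
    (hgood : ∀ i, ∀ u v : U, (u : G) * m i * v = m i → χ u * χ v = 1) :
    LinearIndependent ℂ fun i => heckeElement U χ (m i) := by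
  rw [linearIndependent_iff']
  intro s c hc i hi
  have h := congrArg (fun x : MonoidAlgebra ℂ G => x.coeff (m i)) hc
  simp only [coeff_sum, Finsupp.coe_finsetSum, Finset.sum_apply, coeff_smul, Finsupp.smul_apply,
    coeff_zero, Finsupp.coe_zero, Pi.zero_apply] at h
  rw [Finset.sum_eq_single i] at h
  · exact (smul_eq_zero.mp h).resolve_right (coeff_heckeElement_self_ne_zero (hgood i))
  · intro j _ hj
    rw [coeff_heckeElement_of_not_mem fun u v huv => hj (hdisj _ _ u v huv), smul_zero]
  · exact fun h => absurd hi h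

lemma span_heckeElement
    (hcover : ∀ g, (∃ i, ∃ u v : U, (u : G) * m i * v = g) ∨
      ∃ u v : U, (u : G) * g * v = g ∧ χ u * χ v ≠ 1) :
    Submodule.span ℂ (Set.range fun i => heckeElement U χ (m i)) =
      cornerSubmodule (charIdempotent U χ) := by
  apply le_antisymm
  · rw [Submodule.span_le]
    rintro _ ⟨i, rfl⟩
    exact mem_cornerSubmodule.mpr ⟨_, rfl⟩
  · intro x hx
    obtain ⟨y, rfl⟩ := mem_cornerSubmodule.mp hx
    induction y using MonoidAlgebra.induction_on with
    | of g =>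
      change heckeElement U χ g ∈ _
      rcases hcover g with ⟨i, u, v, rfl⟩ | ⟨u, v, huv, hne⟩
      · rw [heckeElement_mul_mul]
        exact Submodule.smul_mem _ _ (Submodule.subset_span ⟨i, rfl⟩)
      · rw [heckeElement_eq_zero huv hne]
        exact Submodule.zero_mem _
    | add a b ha hb =>
      rw [mul_add, add_mul]
      exact Submodule.add_mem _ (ha (mem_cornerSubmodule.mpr ⟨a, rfl⟩))
        (hb (mem_cornerSubmodule.mpr ⟨b, rfl⟩))
    | smul r a ha =>
      rw [mul_smul_comm, smul_mul_assoc]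
      exact Submodule.smul_mem _ _ (ha (mem_cornerSubmodule.mpr ⟨a, rfl⟩))

/-- Gelfand's trick: an anti-automorphism preserving the character and fixing representatives
of the relevant double cosets forces the Hecke algebra to be commutative. -/
lemma commute_of_antiAutomorphism
    (hcover : ∀ g, (∃ i, ∃ u v : U, (u : G) * m i * v = g) ∨
      ∃ u v : U, (u : G) * g * v = g ∧ χ u * χ v ≠ 1)
    (τ : G →* Gᵐᵒᵖ) (τU : U ≃ U) (hτU : ∀ u : U, τ u = MulOpposite.op (τU u : G))
    (hχ : ∀ u, χ (τU u)⁻¹ = χ u⁻¹) (hm : ∀ i, τ (m i) = MulOpposite.op (m i)) :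
    ∀ x ∈ cornerSubmodule (charIdempotent U χ), ∀ y ∈ cornerSubmodule (charIdempotent U χ),
      x * y = y * x := by
  classical
  let T : MonoidAlgebra ℂ G →ₐ[ℂ] (MonoidAlgebra ℂ G)ᵐᵒᵖ :=
    MonoidAlgebra.lift ℂ _ G ((MonoidHom.op (of ℂ G)).comp τ)
  have hT : ∀ g, T (of ℂ G g) = MulOpposite.op (of ℂ G (τ g).unop) := fun g => by
    rw [MonoidAlgebra.lift_of]; rfl
  have hTe : T (charIdempotent U χ) = MulOpposite.op (charIdempotent U χ) := by
    rw [charIdempotent, map_smul, map_sum, MulOpposite.op_smul, Finset.op_sum]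
    congr 1
    refine Fintype.sum_equiv τU _ _ fun u => ?_
    rw [map_smul, hT, hτU, MulOpposite.op_smul, hχ, MulOpposite.unop_op]
  have hfix : ∀ x ∈ cornerSubmodule (charIdempotent U χ), T x = MulOpposite.op x := by
    intro x hx
    rw [← span_heckeElement m hcover] at hx
    induction hx using Submodule.span_induction with
    | mem x hx =>
      obtain ⟨i, rfl⟩ := hx
      simp only [heckeElement]
      rw [map_mul, map_mul, hT, hTe, hm, MulOpposite.unop_op, ← MulOpposite.op_mul,
        ← MulOpposite.op_mul, mul_assoc]
    | zero => simp
    | add x y _ _ hx hy => rw [map_add, hx, hy, MulOpposite.op_add]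
    | smul c x _ hx => rw [map_smul, hx, MulOpposite.op_smul]
  intro x hx y hy
  have hxy : x * y ∈ cornerSubmodule (charIdempotent U χ) := by
    obtain ⟨a, rfl⟩ := mem_cornerSubmodule.mp hx
    obtain ⟨b, rfl⟩ := mem_cornerSubmodule.mp hy
    exact mem_cornerSubmodule.mpr
      ⟨a * charIdempotent U χ * (charIdempotent U χ * b), by simp only [mul_assoc]⟩
  have h := hfix _ hxy
  rw [map_mul, hfix x hx, hfix y hy, ← MulOpposite.op_mul] at h
  exact (MulOpposite.op_injective h).symm

end Hecke

section Representations

open MonoidAlgebra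

variable {F : Type} [Field F] {n : ℕ}

/-- The algebra homomorphism `ℂ[GL_n(F)] → M_d(ℂ)` of a matrix representation. -/
noncomputable def FinRep.algHom (π : FinRep n F) :
    MonoidAlgebra ℂ (Matrix (Fin n) (Fin n) F)ˣ →ₐ[ℂ] Matrix (Fin π.d) (Fin π.d) ℂ :=
  MonoidAlgebra.lift ℂ _ _ ((Units.coeHom _).comp π.ρ)

lemma FinRep.algHom_of (π : FinRep n F) (g : (Matrix (Fin n) (Fin n) F)ˣ) :
    π.algHom (of ℂ _ g) = (π.ρ g : Matrix (Fin π.d) (Fin π.d) ℂ) := by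
  rw [FinRep.algHom, MonoidAlgebra.lift_of]
  rfl

lemma FinRep.algHom_mulVec_mem (π : FinRep n F) {W : Submodule ℂ (Fin π.d → ℂ)}
    (hW : ∀ g, ∀ v ∈ W, ((π.ρ g : Matrix (Fin π.d) (Fin π.d) ℂ)).mulVec v ∈ W)
    (a : MonoidAlgebra ℂ (Matrix (Fin n) (Fin n) F)ˣ) :
    ∀ v ∈ W, (π.algHom a).mulVec v ∈ W := by
  intro v hv
  induction a using MonoidAlgebra.induction_on with
  | of g => rw [FinRep.algHom_of]; exact hW g v hv
  | add a b ha hb => rw [map_add, Matrix.add_mulVec]; exact W.add_mem ha hb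
  | smul c a ha => rw [map_smul, Matrix.smul_mulVec]; exact W.smul_mem c ha

lemma FinRep.Iso.exists_algHom_intertwining {π σ : FinRep n F} (h : π.Iso σ) :
    ∃ e : (Fin π.d → ℂ) ≃ₗ[ℂ] (Fin σ.d → ℂ),
      ∀ a v, e ((π.algHom a).mulVec v) = (σ.algHom a).mulVec (e v) := by
  obtain ⟨e, he⟩ := h
  refine ⟨e, fun a v => ?_⟩
  induction a using MonoidAlgebra.induction_on with
  | of g => rw [FinRep.algHom_of, FinRep.algHom_of, he]
  | add a b ha hb =>
    rw [map_add, map_add, Matrix.add_mulVec, Matrix.add_mulVec, map_add, ha, hb]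
  | smul c a ha =>
    rw [map_smul, map_smul, Matrix.smul_mulVec, Matrix.smul_mulVec, map_smul, ha]

variable [Fintype F] [DecidableEq F]

lemma FinRep.generic_iff_algHom_charIdempotent_ne_zero {ψ : AddChar F ℂ}
    {U : Subgroup (Matrix (Fin n) (Fin n) F)ˣ} {χ : U →* ℂ}
    (hU : ∀ u, u ∈ U ↔ IsUnipUpper (u : Matrix (Fin n) (Fin n) F))
    (hχ : ∀ u : U, χ u = psiU ψ (u.1 : Matrix (Fin n) (Fin n) F)) (π : FinRep n F) :
    π.Generic ψ ↔ π.algHom (charIdempotent U χ) ≠ 0 := by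
  classical
  constructor
  · rintro ⟨ℓ, hℓ0, hℓ⟩ h0
    apply hℓ0
    ext1 v
    have h1 : ∀ v, ℓ ((π.algHom (charIdempotent U χ)).mulVec v) = ℓ v := by
      intro v
      rw [charIdempotent, map_smul, map_sum, Matrix.smul_mulVec, map_smul, Matrix.sum_mulVec,
        map_sum]
      have h2 : ∀ u : U, ℓ ((π.algHom (χ u⁻¹ • of ℂ _ (u : (Matrix (Fin n) (Fin n) F)ˣ))).mulVec v)
          = ℓ v := by
        intro u
        rw [map_smul, Matrix.smul_mulVec, map_smul, FinRep.algHom_of, hℓ _ ((hU _).mp u.2),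
          ← hχ, smul_eq_mul, ← mul_assoc, char_inv_mul_self, one_mul]
      simp only [h2]
      rw [Finset.sum_const, Finset.card_univ, ← Nat.cast_smul_eq_nsmul ℂ, smul_smul,
        inv_mul_cancel₀ (Nat.cast_ne_zero.mpr Fintype.card_ne_zero), one_smul]
    have := h1 (Pi.single v 1)
    rw [h0, Matrix.zero_mulVec, map_zero] at this
    ext
    simpa using this.symm
  · intro hne
    obtain ⟨i, j, hij⟩ : ∃ i j, π.algHom (charIdempotent U χ) i j ≠ 0 := by
      by_contra! h
      exact hne (Matrix.ext h)
    refine ⟨(LinearMap.proj i).comp (Matrix.mulVecLin (π.algHom (charIdempotent U χ))), ?_, ?_⟩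
    · intro h
      have := LinearMap.congr_fun h (Pi.single j 1)
      simp at this
      exact hij this
    · intro u hu v
      have h := charIdempotent_mul_of (χ := χ) ⟨u, (hU u).mpr hu⟩
      have h1 := congrArg π.algHom h
      rw [map_mul, map_smul, FinRep.algHom_of] at h1
      simp only [LinearMap.comp_apply, Matrix.mulVecLin_apply, LinearMap.proj_apply,
        Matrix.mulVec_mulVec]
      rw [h1, Matrix.smul_mulVec, hχ]
      rfl

lemma exists_generic_representatives {ψ : AddChar F ℂ}
    {U : Subgroup (Matrix (Fin n) (Fin n) F)ˣ} {χ : U →* ℂ}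
    (hU : ∀ u, u ∈ U ↔ IsUnipUpper (u : Matrix (Fin n) (Fin n) F))
    (hχ : ∀ u : U, χ u = psiU ψ (u.1 : Matrix (Fin n) (Fin n) F))
    (hc : ∀ x ∈ cornerSubmodule (charIdempotent U χ), ∀ y ∈ cornerSubmodule (charIdempotent U χ),
      x * y = y * x) :
    ∃ (ι : Type) (_ : Fintype ι) (σ : ι → FinRep n F),
      (∀ i, (σ i).Irreducible ∧ (σ i).Generic ψ) ∧
      (∀ i j, (σ i).Iso (σ j) → i = j) ∧
      (∀ τ : FinRep n F, τ.Irreducible → τ.Generic ψ → ∃ i, τ.Iso (σ i)) ∧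
      Nat.card ι = Module.finrank ℂ (cornerSubmodule (charIdempotent U χ)) := by
  classical
  obtain ⟨k, d, hd, ⟨Φ⟩⟩ := IsSemisimpleRing.exists_algEquiv_pi_matrix_of_isAlgClosed
    (F := ℂ) (R := MonoidAlgebra ℂ (Matrix (Fin n) (Fin n) F)ˣ)
  let rep : Fin k → FinRep n F := fun i =>
    { d := d i
      ρ := MonoidHom.toHomUnits
        (((Pi.evalAlgHom ℂ (fun i => Matrix (Fin (d i)) (Fin (d i)) ℂ) i).comp
          Φ.toAlgHom : _ →* _).comp (of ℂ _)) }
  have hrep : ∀ i a, (rep i).algHom a = Φ a i := by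
    intro i a
    induction a using MonoidAlgebra.induction_on with
    | of g => rw [FinRep.algHom_of]; rfl
    | add a b ha hb => rw [map_add, map_add, ha, hb]; rfl
    | smul c a ha => rw [map_smul, map_smul, ha]; rfl
  have hgen : ∀ i, (rep i).Generic ψ ↔ Φ (charIdempotent U χ) i ≠ 0 := fun i => by
    rw [FinRep.generic_iff_algHom_charIdempotent_ne_zero hU hχ, hrep]
  refine ⟨{i // Φ (charIdempotent U χ) i ≠ 0}, inferInstance, fun i => rep i.1, ?_, ?_, ?_,
    finrank_corner_eq_card Φ charIdempotent_mul_self hc⟩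
  · intro i
    refine ⟨⟨Nat.pos_of_ne_zero (hd i.1).out, fun W hW => ?_⟩, (hgen _).mpr i.2⟩
    refine submodule_eq_bot_or_top_of_matrix_invariant (m := d i.1) W fun M v hv => ?_
    have h := (rep i.1).algHom_mulVec_mem hW (Φ.symm (Pi.single i.1 M)) v hv
    rw [hrep, Φ.apply_symm_apply, Pi.single_eq_same] at h
    exact h
  · intro i j hij
    obtain ⟨e, he⟩ := hij.exists_algHom_intertwining
    by_contra hne
    have hne' : j.1 ≠ i.1 := fun h => hne (Subtype.ext h.symm)
    have h := he (Φ.symm (Pi.single i.1 1)) (fun _ => 1)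
    rw [hrep, hrep, Φ.apply_symm_apply, Pi.single_eq_same, Pi.single_eq_of_ne hne',
      Matrix.zero_mulVec] at h
    have h2 := (map_eq_zero_iff e e.injective).mp h
    have h3 : (fun _ => 1 : Fin (d i.1) → ℂ) = 0 := by
      rw [← h2]
      exact (Matrix.one_mulVec _).symm
    have := congrFun h3 ⟨0, Nat.pos_of_ne_zero (hd i.1).out⟩
    simp at this
  · intro τ hirr hτ
    obtain ⟨i, e, he⟩ := exists_component_of_irreducible
      (τ.algHom.comp Φ.symm.toAlgHom) hirr.1 fun W hW => hirr.2 W fun g v hv => by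
        have h := hW (Φ (of ℂ _ g)) v hv
        have h2 : (τ.algHom.comp Φ.symm.toAlgHom) (Φ (of ℂ _ g)) = τ.algHom (of ℂ _ g) :=
          congrArg τ.algHom (Φ.symm_apply_apply _)
        rwa [h2, FinRep.algHom_of] at h
    have he' : ∀ a v, e ((τ.algHom a).mulVec v) = (Φ a i).mulVec (e v) := by
      intro a v
      rw [← he]
      congr 2
      exact congrArg τ.algHom (Φ.symm_apply_apply _).symm
    refine ⟨⟨i, fun h0 => ?_⟩, e, fun g v => ?_⟩
    · rw [FinRep.generic_iff_algHom_charIdempotent_ne_zero hU hχ] at hτ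
      apply hτ
      refine Matrix.ext_of_mulVec_single fun j => ?_
      rw [Matrix.zero_mulVec]
      apply e.injective
      rw [he', h0, Matrix.zero_mulVec, map_zero]
    · rw [← FinRep.algHom_of, he']
      rfl

end Representations

section Unipotent

variable {F : Type} [Field F] {n : ℕ}

/-- The sum of the entries directly above the diagonal. -/
def superdiagSum (u : Matrix (Fin n) (Fin n) F) : F :=
  ∑ x : Fin n × Fin n with (x.1 : ℕ) + 1 = x.2, u x.1 x.2

lemma psiU_eq (ψ : AddChar F ℂ) (u : Matrix (Fin n) (Fin n) F) :
    psiU ψ u = ψ (superdiagSum u) := by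
  rw [psiU, superdiagSum]
  congr 1
  refine Finset.sum_bij (fun i _ => (⟨⟨(i : ℕ), lt_of_lt_of_le i.isLt (Nat.sub_le n 1)⟩,
    ⟨(i : ℕ) + 1, by have := i.isLt; omega⟩⟩ : Fin n × Fin n)) ?_ ?_ ?_ ?_
  · simp
  · intro a _ b _ h
    simpa [Fin.ext_iff] using h
  · rintro ⟨i, j⟩ h
    simp only [Finset.mem_filter, Finset.mem_univ, true_and] at h
    refine ⟨⟨i, by have := j.isLt; omega⟩, Finset.mem_univ _, ?_⟩
    simp [h]
  · intros; rfl

lemma isUnipUpper_one : IsUnipUpper (1 : Matrix (Fin n) (Fin n) F) :=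
  ⟨fun i => Matrix.one_apply_eq i, fun _ _ h => Matrix.one_apply_ne (fun e => by simp [e] at h)⟩

lemma IsUnipUpper.mul {u v : Matrix (Fin n) (Fin n) F} (hu : IsUnipUpper u) (hv : IsUnipUpper v) :
    IsUnipUpper (u * v) := by
  constructor
  · intro i
    rw [Matrix.mul_apply, Finset.sum_eq_single i, hu.1, hv.1, one_mul]
    · intro k _ hk
      rcases lt_or_gt_of_ne (fun h => hk (Fin.ext h) : (k : ℕ) ≠ i) with h | h
      · rw [hu.2 i k h, zero_mul]
      · rw [hv.2 k i h, mul_zero]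
    · simp
  · intro i j hij
    rw [Matrix.mul_apply]
    refine Finset.sum_eq_zero fun k _ => ?_
    rcases lt_or_ge (k : ℕ) i with h | h
    · rw [hu.2 i k h, zero_mul]
    · rw [hv.2 k j (by omega), mul_zero]

lemma superdiagSum_mul {u v : Matrix (Fin n) (Fin n) F} (hu : IsUnipUpper u)
    (hv : IsUnipUpper v) : superdiagSum (u * v) = superdiagSum u + superdiagSum v := by
  rw [superdiagSum, superdiagSum, superdiagSum, ← Finset.sum_add_distrib]
  refine Finset.sum_congr rfl ?_
  rintro ⟨i, j⟩ h
  simp only [Finset.mem_filter, Finset.mem_univ, true_and] at h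
  have hij : i ≠ j := fun e => by rw [e] at h; omega
  simp only
  rw [Matrix.mul_apply, Finset.sum_eq_add i j hij, hu.1, hv.1, one_mul, mul_one, add_comm]
  · rintro k _ ⟨hki, hkj⟩
    have h1 : (k : ℕ) ≠ i := fun e => hki (Fin.ext e)
    have h2 : (k : ℕ) ≠ j := fun e => hkj (Fin.ext e)
    rcases lt_or_gt_of_ne h1 with h3 | h3
    · rw [hu.2 i k h3, zero_mul]
    · rw [hv.2 k j (by omega), mul_zero]
  · simp
  · simp

lemma isUnipUpper_transvection {i j : Fin n} (hij : i < j) (x : F) :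
    IsUnipUpper (Matrix.transvection i j x) := by
  constructor
  · intro k
    rw [Matrix.transvection, Matrix.add_apply, Matrix.one_apply_eq, Matrix.single_apply_of_ne,
      add_zero]
    rintro ⟨rfl, rfl⟩
    exact lt_irrefl _ hij
  · intro k l hkl
    rw [Matrix.transvection, Matrix.add_apply, Matrix.one_apply_ne, Matrix.single_apply_of_ne,
      add_zero]
    · rintro ⟨rfl, rfl⟩
      exact lt_asymm hij hkl
    · rintro rfl
      exact lt_irrefl _ hkl

lemma superdiagSum_transvection {i j : Fin n} (x : F) :
    superdiagSum (Matrix.transvection i j x) = if (i : ℕ) + 1 = j then x else 0 := by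
  rw [superdiagSum]
  have : ∀ y ∈ Finset.univ.filter (fun y : Fin n × Fin n => (y.1 : ℕ) + 1 = y.2),
      Matrix.transvection i j x y.1 y.2 = if y = (i, j) then x else 0 := by
    rintro ⟨k, l⟩ h
    simp only [Finset.mem_filter, Finset.mem_univ, true_and] at h
    have hkl : k ≠ l := fun e => by rw [e] at h; omega
    simp only [Matrix.transvection, Matrix.add_apply, Matrix.one_apply_ne hkl, zero_add,
      Matrix.single_apply, Prod.mk.injEq]
    simp only [eq_comm]
  rw [Finset.sum_congr rfl this, Finset.sum_ite_eq']
  simp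

/-- Transposition along the anti-diagonal. -/
def antiTranspose {R : Type} (g : Matrix (Fin n) (Fin n) R) : Matrix (Fin n) (Fin n) R :=
  fun i j => g j.rev i.rev

lemma antiTranspose_mul (g h : Matrix (Fin n) (Fin n) F) :
    antiTranspose (g * h) = antiTranspose h * antiTranspose g := by
  ext i j
  simp only [antiTranspose, Matrix.mul_apply]
  exact Fintype.sum_equiv Fin.revPerm _ _ fun k => by simp [mul_comm]

lemma antiTranspose_one : antiTranspose (1 : Matrix (Fin n) (Fin n) F) = 1 := by
  ext i j
  simp [antiTranspose, Matrix.one_apply, eq_comm]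

lemma antiTranspose_antiTranspose {R : Type} (g : Matrix (Fin n) (Fin n) R) :
    antiTranspose (antiTranspose g) = g := by
  ext i j
  simp [antiTranspose]

lemma IsUnipUpper.antiTranspose {u : Matrix (Fin n) (Fin n) F} (hu : IsUnipUpper u) :
    IsUnipUpper (antiTranspose u) :=
  ⟨fun _ => hu.1 _, fun i j hij => hu.2 _ _ (by simp only [Fin.val_rev]; omega)⟩

lemma superdiagSum_antiTranspose (u : Matrix (Fin n) (Fin n) F) :
    superdiagSum (antiTranspose u) = superdiagSum u := by
  rw [superdiagSum, superdiagSum]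
  refine Finset.sum_bij' (fun x _ => (x.2.rev, x.1.rev)) (fun x _ => (x.2.rev, x.1.rev))
    ?_ ?_ ?_ ?_ ?_
  · rintro ⟨i, j⟩ h
    simp only [Finset.mem_filter, Finset.mem_univ, true_and, Fin.val_rev] at h ⊢
    omega
  · rintro ⟨i, j⟩ h
    simp only [Finset.mem_filter, Finset.mem_univ, true_and, Fin.val_rev] at h ⊢
    omega
  · simp
  · simp
  · intros; rfl

/-- Transposition along the anti-diagonal, as an anti-automorphism of `GL_n`. -/
def antiTransposeHom :
    (Matrix (Fin n) (Fin n) F)ˣ →* ((Matrix (Fin n) (Fin n) F)ˣ)ᵐᵒᵖ where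
  toFun g := MulOpposite.op
    { val := antiTranspose g
      inv := antiTranspose (g⁻¹ : (Matrix (Fin n) (Fin n) F)ˣ)
      val_inv := by rw [← antiTranspose_mul, Units.inv_mul, antiTranspose_one]
      inv_val := by rw [← antiTranspose_mul, Units.mul_inv, antiTranspose_one] }
  map_one' := by
    apply MulOpposite.unop_injective
    exact Units.ext antiTranspose_one
  map_mul' g h := by
    apply MulOpposite.unop_injective
    exact Units.ext (antiTranspose_mul _ _)

variable [Finite F]

variable (F n) in
/-- The group of upper unitriangular matrices. -/
def unipSubgroup : Subgroup (Matrix (Fin n) (Fin n) F)ˣ where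
  carrier := {u | IsUnipUpper (u : Matrix (Fin n) (Fin n) F)}
  mul_mem' ha hb := ha.mul hb
  one_mem' := isUnipUpper_one
  inv_mem' {u} hu := by
    have hpow : ∀ k : ℕ, IsUnipUpper ((u ^ k : (Matrix (Fin n) (Fin n) F)ˣ) :
        Matrix (Fin n) (Fin n) F) := by
      intro k
      induction k with
      | zero => rw [pow_zero]; exact isUnipUpper_one
      | succ k ih => rw [pow_succ]; exact ih.mul hu
    obtain ⟨k, hk⟩ := mem_powers_iff_mem_zpowers.mpr
      ((Subgroup.zpowers u).inv_mem (Subgroup.mem_zpowers u))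
    have h := hpow k
    rw [show u ^ k = u⁻¹ from hk] at h
    exact h

/-- The character of the unitriangular group attached to `ψ`. -/
noncomputable def unipChar (ψ : AddChar F ℂ) : unipSubgroup F n →* ℂ where
  toFun u := psiU ψ (u.1 : Matrix (Fin n) (Fin n) F)
  map_one' := by
    have h := superdiagSum_mul (isUnipUpper_one (F := F) (n := n)) isUnipUpper_one
    rw [mul_one, left_eq_add] at h
    rw [psiU_eq]
    exact (congrArg ψ h).trans ψ.map_zero_eq_one
  map_mul' u v := by
    rw [psiU_eq, psiU_eq, psiU_eq, ← ψ.map_add_eq_mul, ← superdiagSum_mul u.2 v.2]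
    rfl

/-- Transposition along the anti-diagonal on the unitriangular group. -/
def unipAntiTranspose : unipSubgroup F n ≃ unipSubgroup F n where
  toFun u := ⟨(antiTransposeHom u.1).unop, IsUnipUpper.antiTranspose u.2⟩
  invFun u := ⟨(antiTransposeHom u.1).unop, IsUnipUpper.antiTranspose u.2⟩
  left_inv _ := Subtype.ext (Units.ext (antiTranspose_antiTranspose _))
  right_inv _ := Subtype.ext (Units.ext (antiTranspose_antiTranspose _))

lemma unipChar_unipAntiTranspose (ψ : AddChar F ℂ) (u : unipSubgroup F n) :
    unipChar ψ (unipAntiTranspose u) = unipChar ψ u := by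
  change psiU ψ _ = psiU ψ _
  rw [psiU_eq, psiU_eq, ← superdiagSum_antiTranspose (u.1 : Matrix (Fin n) (Fin n) F)]
  rfl

end Unipotent

section Layered

/-- A permutation of `ℕ` all of whose descents have size one decreases with slope `-1` between
the two positions of any inversion. -/
lemma apply_add_of_inversion {p : ℕ → ℕ} (hp : Function.Injective p)
    (hstep : ∀ j, p (j + 1) < p j → p (j + 1) + 1 = p j) :
    ∀ k j, p (j + k) < p j → ∀ i ≤ k, p (j + i) + i = p j := by
  intro k
  induction k with
  | zero => intro j h; exact absurd h (lt_irrefl _)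
  | succ k ih =>
    intro j h i hi
    have hne : p (j + 1) ≠ p j := fun e => by have := hp e; omega
    rcases lt_or_gt_of_ne hne with hlt | hgt
    · have h1 := hstep j hlt
      rcases Nat.eq_zero_or_pos i with rfl | hi0
      · rfl
      rcases Nat.eq_zero_or_pos k with rfl | hk0
      · obtain rfl : i = 1 := by omega
        exact h1
      · have hne2 : p (j + (k + 1)) ≠ p (j + 1) := fun e => by have := hp e; omega
        have h2 := ih (j + 1) (by rw [add_assoc, add_comm 1 k]; omega) (i - 1) (by omega)
        rw [show j + 1 + (i - 1) = j + i by omega] at h2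
        omega
    · rw [show j + (k + 1) = j + 1 + k by omega] at h
      have h1 := ih (j + 1) (by omega)
      have h2 := h1 k le_rfl
      have h3 := h1 (p (j + 1) - p j) (by omega)
      have h4 : p (j + 1 + (p (j + 1) - p j)) = p j := by omega
      have := hp h4
      omega

lemma apply_apply_of_layered (p : Equiv.Perm ℕ)
    (hstep : ∀ j, p (j + 1) < p j → p (j + 1) + 1 = p j) (j : ℕ) : p (p j) = j := by
  have hrun := apply_add_of_inversion p.injective hstep
  have hrun' : ∀ j k, j ≤ k → p k < p j → ∀ l, j ≤ l → l ≤ k → p l + l = p j + j := by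
    intro j k hjk h l hl hlk
    have := hrun (k - j) j (by rwa [show j + (k - j) = k by omega]) (l - j) (by omega)
    rw [show j + (l - j) = l by omega] at this
    omega
  have hpigeon : ∀ i : ℕ, ¬ ∀ k ≤ i, p k < i := by
    intro i h
    have := Finset.card_le_card_of_injOn (s := Finset.range (i + 1)) (t := Finset.range i) p
      (fun k hk => by
        rw [Finset.coe_range, Set.mem_Iio] at hk ⊢
        exact h k (by omega)) p.injective.injOn
    simp at this
  have hpigeon' : ∀ i : ℕ, ¬ ∀ k ≤ i, p.symm k < i := by
    intro i h
    have := Finset.card_le_card_of_injOn (s := Finset.range (i + 1)) (t := Finset.range i) p.symm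
      (fun k hk => by
        rw [Finset.coe_range, Set.mem_Iio] at hk ⊢
        exact h k (by omega)) p.symm.injective.injOn
    simp at this
  obtain ⟨i, hi⟩ : ∃ i, p j = i := ⟨_, rfl⟩
  rw [hi]
  rcases lt_trichotomy i j with hij | hij | hij
  · have h1 : p j < p i := by
      by_contra! h
      apply hpigeon i
      intro k hk
      by_contra! hk2
      have hne : p k ≠ p j := fun e => by have := p.injective e; omega
      have h3 := hrun' k j (by omega) (by omega) i hk hij.le
      have h4 := hrun' k j (by omega) (by omega) j (by omega) le_rfl
      omega
    have := hrun' i j hij.le h1 j hij.le le_rfl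
    omega
  · rw [← hij] at hi
    rw [hi, hij]
  · have h1 : p i < p j := by
      by_contra! h
      apply hpigeon' i
      intro k hk
      by_contra! hk2
      obtain ⟨l, rfl⟩ := p.surjective k
      rw [p.symm_apply_apply] at hk2
      have hne : p l ≠ p j := fun e => by have := p.injective e; omega
      have h3 := hrun' j l (by omega) (by omega) i hij.le hk2
      omega
    have := hrun' j i hij.le h1 i hij.le le_rfl
    omega

variable (D : ℕ → Prop)

/-- `[s, t)` is a block of the set partition of `ℕ` into intervals starting at the points
of `D`. -/
def IsBlock (s t : ℕ) : Prop := D s ∧ D t ∧ ∀ k, s < k → k < t → ¬ D k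

open scoped Classical in
/-- The left end of the block containing `j`. -/
noncomputable def blockStart (j : ℕ) : ℕ := Nat.findGreatest D j

/-- The right end (excluded) of the block containing `j`. -/
noncomputable def blockEnd (j : ℕ) : ℕ := sInf {k | j < k ∧ D k}

/-- The involution of `ℕ` reversing every block. -/
noncomputable def blockReverse (j : ℕ) : ℕ := blockStart D j + blockEnd D j - 1 - j

variable {D}

lemma isBlock_blockStart_blockEnd {n : ℕ} (h0 : D 0) (hn : ∀ k, n ≤ k → D k) (j : ℕ) :
    blockStart D j ≤ j ∧ j < blockEnd D j ∧ IsBlock D (blockStart D j) (blockEnd D j) := by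
  classical
  have hmem : blockEnd D j ∈ {k | j < k ∧ D k} :=
    Nat.sInf_mem ⟨n + j + 1, by omega, hn _ (by omega)⟩
  refine ⟨Nat.findGreatest_le j, hmem.1, Nat.findGreatest_spec (Nat.zero_le j) h0, hmem.2,
    fun k h1 h2 h3 => ?_⟩
  rcases le_or_gt k j with hk | hk
  · exact Nat.findGreatest_is_greatest h1 hk h3
  · exact Nat.notMem_of_lt_sInf h2 ⟨hk, h3⟩

lemma IsBlock.blockStart_eq {s t j : ℕ} (h : IsBlock D s t) (hs : s ≤ j) (ht : j < t) :
    blockStart D j = s := by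
  classical
  rw [blockStart, Nat.findGreatest_eq_iff]
  exact ⟨hs, fun _ => h.1, fun k h1 h2 => h.2.2 k h1 (by omega)⟩

lemma IsBlock.blockEnd_eq {s t j : ℕ} (h : IsBlock D s t) (hs : s ≤ j) (ht : j < t) :
    blockEnd D j = t := by
  have hmem : t ∈ {k | j < k ∧ D k} := ⟨ht, h.2.1⟩
  refine le_antisymm (Nat.sInf_le hmem) ?_
  by_contra! hlt
  have := Nat.sInf_mem ⟨t, hmem⟩
  exact h.2.2 _ (lt_of_le_of_lt hs this.1) hlt this.2

lemma IsBlock.blockReverse_add {s t j : ℕ} (h : IsBlock D s t) (hs : s ≤ j) (ht : j < t) :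
    blockReverse D j + j + 1 = s + t := by
  rw [blockReverse, h.blockStart_eq hs ht, h.blockEnd_eq hs ht]
  omega

lemma blockStart_blockReverse {n : ℕ} (h0 : D 0) (hn : ∀ k, n ≤ k → D k) (j : ℕ) :
    blockStart D (blockReverse D j) = blockStart D j := by
  obtain ⟨hs, ht, hb⟩ := isBlock_blockStart_blockEnd h0 hn j
  have := hb.blockReverse_add hs ht
  exact hb.blockStart_eq (by omega) (by omega)

lemma involutive_blockReverse {n : ℕ} (h0 : D 0) (hn : ∀ k, n ≤ k → D k) :
    Function.Involutive (blockReverse D) := by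
  intro j
  obtain ⟨hs, ht, hb⟩ := isBlock_blockStart_blockEnd h0 hn j
  have h1 := hb.blockReverse_add hs ht
  have h2 := hb.blockReverse_add (j := blockReverse D j) (by omega) (by omega)
  omega

lemma blockReverse_lt {n : ℕ} (h0 : D 0) (hn : ∀ k, n ≤ k → D k) {j : ℕ} (hj : j < n) :
    blockReverse D j < n := by
  obtain ⟨hs, ht, hb⟩ := isBlock_blockStart_blockEnd h0 hn j
  have h1 := hb.blockReverse_add hs ht
  have h2 : blockEnd D j ≤ n := by
    by_contra! h
    exact hb.2.2 n (by omega) h (hn n le_rfl)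
  omega

lemma blockReverse_step {n : ℕ} (h0 : D 0) (hn : ∀ k, n ≤ k → D k) {j : ℕ}
    (h : blockReverse D (j + 1) < blockReverse D j) :
    blockReverse D (j + 1) + 1 = blockReverse D j ∧ blockStart D (j + 1) = blockStart D j := by
  obtain ⟨hs, ht, hb⟩ := isBlock_blockStart_blockEnd h0 hn j
  obtain ⟨hs', ht', hb'⟩ := isBlock_blockStart_blockEnd h0 hn (j + 1)
  have h1 := hb.blockReverse_add hs ht
  have h1' := hb'.blockReverse_add hs' ht'
  have h2 : j + 1 < blockEnd D j := by
    by_contra! h2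
    have h3 : j + 1 = blockEnd D j := by omega
    have h4 : blockStart D (j + 1) = j + 1 := by
      by_contra h5
      exact hb'.2.2 (j + 1) (by omega) ht' (h3 ▸ hb.2.1)
    omega
  have h3 := hb.blockReverse_add (j := j + 1) (by omega) h2
  exact ⟨by omega, hb.blockStart_eq (by omega) h2⟩

lemma start_iff_blockReverse_lt {n : ℕ} (h0 : D 0) (hn : ∀ k, n ≤ k → D k) (j : ℕ) :
    D j ↔ j = 0 ∨ blockReverse D (j - 1) < blockReverse D j := by
  rcases Nat.eq_zero_or_pos j with rfl | hj
  · simp [h0]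
  obtain ⟨hs, ht, hb⟩ := isBlock_blockStart_blockEnd h0 hn j
  have h1 := hb.blockReverse_add hs ht
  constructor
  · intro hD
    right
    obtain ⟨hs', ht', hb'⟩ := isBlock_blockStart_blockEnd h0 hn (j - 1)
    have h2 := hb'.blockReverse_add hs' ht'
    have h3 : blockStart D j = j := by
      by_contra h
      exact hb.2.2 j (by omega) ht hD
    have h4 : blockEnd D (j - 1) ≤ j := by
      by_contra! h
      exact hb'.2.2 j (by omega) h hD
    omega
  · intro h
    by_contra hD
    have hne : blockStart D j ≠ j := fun e => hD (e ▸ hb.1)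
    have h2 := hb.blockReverse_add (j := j - 1) (by omega) (by omega)
    omega

lemma blockStart_eq_self {n : ℕ} (h0 : D 0) (hn : ∀ k, n ≤ k → D k) {j : ℕ} (hj : D j) :
    blockStart D j = j := by
  obtain ⟨hs, ht, hb⟩ := isBlock_blockStart_blockEnd h0 hn j
  by_contra h
  exact hb.2.2 j (by omega) ht hj

/-- A permutation all of whose descents have size one reverses the blocks cut out by its
ascents. -/
lemma eq_blockReverse_of_layered {n : ℕ} (p : Equiv.Perm ℕ)
    (hstep : ∀ j, p (j + 1) < p j → p (j + 1) + 1 = p j)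
    (h0 : D 0) (hn : ∀ k, n ≤ k → D k) (hD : ∀ j, D (j + 1) ↔ p j < p (j + 1)) (j : ℕ) :
    p j = blockReverse D j := by
  have hinv := apply_apply_of_layered p hstep
  have hrun := apply_add_of_inversion p.injective hstep
  have hrun' : ∀ j k, j ≤ k → p k < p j → ∀ l, j ≤ l → l ≤ k → p l + l = p j + j := by
    intro j k hjk h l hl hlk
    have := hrun (k - j) j (by rwa [show j + (k - j) = k by omega]) (l - j) (by omega)
    rw [show j + (l - j) = l by omega] at this
    omega
  have hD' : ∀ k, 0 < k → D k → p (k - 1) < p k := fun k hk h => by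
    have := (hD (k - 1)).mp (by rwa [Nat.sub_add_cancel hk])
    rwa [Nat.sub_add_cancel hk] at this
  have hnD : ∀ k, 0 < k → ¬ D k → p k + 1 = p (k - 1) := fun k hk h => by
    have h1 : ¬ p (k - 1) < p k := fun h2 => h (by
      have := (hD (k - 1)).mpr (by rwa [Nat.sub_add_cancel hk])
      rwa [Nat.sub_add_cancel hk] at this)
    have hne : p (k - 1) ≠ p k := fun e => by have := p.injective e; omega
    have := hstep (k - 1) (by rw [Nat.sub_add_cancel hk]; omega)
    rwa [Nat.sub_add_cancel hk] at this
  obtain ⟨hs, ht, hb⟩ := isBlock_blockStart_blockEnd h0 hn j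
  have h1 := hb.blockReverse_add hs ht
  generalize blockStart D j = s at *
  generalize blockEnd D j = t at *
  have hlin : ∀ k, s + k < t → p (s + k) + k = p s := by
    intro k
    induction k with
    | zero => intro; rfl
    | succ k ih =>
      intro hk
      have := hnD (s + (k + 1)) (by omega) (hb.2.2 _ (by omega) hk)
      rw [show s + (k + 1) - 1 = s + k by omega] at this
      have := ih (by omega)
      omega
  have hge : s ≤ p s := by
    by_contra! h
    have h2 := hrun' (p s) s h.le (by rw [hinv]; exact h) (s - 1) (by omega) (by omega)
    have h3 := hD' s (by omega) hb.1
    rw [hinv] at h2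
    omega
  have hps : p s + 1 = t := by
    rcases lt_trichotomy (p s + 1) t with h | h | h
    · exfalso
      have h2 := hlin (p s + 1 - s) (by omega)
      rw [show s + (p s + 1 - s) = p s + 1 by omega] at h2
      have h3 := hinv (p s + 1)
      have h4 : p (p s + 1) = s - 1 := by omega
      have h5 := hD' s (by omega) hb.1
      rw [h4] at h3
      omega
    · exact h
    · exfalso
      have h4 : s < p s := by omega
      have h2 := hrun' s (p s) h4.le (by rw [hinv]; exact h4)
      have h3 := h2 t (by omega) (by omega)
      have h5 := h2 (t - 1) (by omega) (by omega)
      have h6 := hD' t (by omega) hb.2.1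
      omega
  have h2 := hlin (j - s) (by omega)
  rw [show s + (j - s) = j by omega] at h2
  omega

end Layered

section Bruhat

variable {F : Type} [Field F] {n : ℕ}

/-- The monomial matrix with entries `a i` at the positions `(i, σ i)`. -/
def monomialMatrix (σ : Equiv.Perm (Fin n)) (a : Fin n → F) : Matrix (Fin n) (Fin n) F :=
  fun i j => if σ i = j then a i else 0

lemma mul_monomialMatrix_apply (u : Matrix (Fin n) (Fin n) F) (σ : Equiv.Perm (Fin n))
    (a : Fin n → F) (i k : Fin n) : (u * monomialMatrix σ a) i (σ k) = u i k * a k := by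
  simp [Matrix.mul_apply, monomialMatrix]

lemma monomialMatrix_mul_apply (v : Matrix (Fin n) (Fin n) F) (σ : Equiv.Perm (Fin n))
    (a : Fin n → F) (i l : Fin n) : (monomialMatrix σ a * v) i l = a i * v (σ i) l := by
  simp [Matrix.mul_apply, monomialMatrix]

lemma mul_monomialMatrix_eq_iff {u v : Matrix (Fin n) (Fin n) F} {σ σ' : Equiv.Perm (Fin n)}
    {a a' : Fin n → F} : u * monomialMatrix σ a = monomialMatrix σ' a' * v ↔
      ∀ i k, u i k * a k = a' i * v (σ' i) (σ k) := by
  constructor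
  · intro h i k
    rw [← mul_monomialMatrix_apply, h, monomialMatrix_mul_apply]
  · intro h
    ext i l
    obtain ⟨k, rfl⟩ := σ.surjective l
    rw [mul_monomialMatrix_apply, monomialMatrix_mul_apply, h]

lemma isUnit_monomialMatrix (σ : Equiv.Perm (Fin n)) {a : Fin n → F} (ha : ∀ i, a i ≠ 0) :
    IsUnit (monomialMatrix σ a) := by
  refine IsUnit.of_mul_eq_one (Matrix.of fun i j => if σ j = i then (a j)⁻¹ else 0) ?_
  ext i j
  rw [monomialMatrix_mul_apply, Matrix.one_apply, Matrix.of_apply]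
  by_cases h : i = j
  · subst h; simp [ha]
  · simp [h, Ne.symm h]

lemma IsUnipUpper.isUnit {u : Matrix (Fin n) (Fin n) F} (hu : IsUnipUpper u) : IsUnit u := by
  rw [Matrix.isUnit_iff_isUnit_det, Matrix.det_of_isUpperTriangular (fun i j h => hu.2 i j h)]
  simp [hu.1]

lemma monomialMatrix_unique {u v : Matrix (Fin n) (Fin n) F} (hu : IsUnipUpper u)
    (hv : IsUnipUpper v) {σ σ' : Equiv.Perm (Fin n)} {a a' : Fin n → F} (ha : ∀ i, a i ≠ 0)
    (h : u * monomialMatrix σ a = monomialMatrix σ' a' * v) : σ = σ' ∧ a = a' := by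
  rw [mul_monomialMatrix_eq_iff] at h
  have h1 : ∀ k, a k = a' k * v (σ' k) (σ k) := fun k => by rw [← h, hu.1, one_mul]
  have hle : ∀ k, (σ' k : ℕ) ≤ σ k := by
    intro k
    by_contra! hlt
    have h2 := h1 k
    rw [hv.2 _ _ hlt, mul_zero] at h2
    exact ha k h2
  have hsum : ∑ k, (σ' k : ℕ) = ∑ k, (σ k : ℕ) := by
    rw [Equiv.sum_comp σ' (fun k => (k : ℕ)), Equiv.sum_comp σ (fun k => (k : ℕ))]
  rw [Finset.sum_eq_sum_iff_of_le fun k _ => hle k] at hsum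
  have hσ : σ = σ' := Equiv.ext fun k => Fin.ext (hsum k (Finset.mem_univ k)).symm
  refine ⟨hσ, funext fun k => ?_⟩
  rw [h1, hσ, hv.1, mul_one]

lemma psiU_eq_of_mul_monomialMatrix {u v : Matrix (Fin n) (Fin n) F} (hu : IsUnipUpper u)
    (hv : IsUnipUpper v) (ψ : AddChar F ℂ) {σ : Equiv.Perm (Fin n)} {a : Fin n → F}
    (ha : ∀ i, a i ≠ 0) (h1 : ∀ i j : Fin n, (i : ℕ) + 1 = j → σ i < σ j →
      (σ i : ℕ) + 1 = σ j ∧ a i = a j)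
    (h2 : ∀ i j : Fin n, i < j → (σ i : ℕ) + 1 = σ j → (i : ℕ) + 1 = j)
    (h : u * monomialMatrix σ a = monomialMatrix σ a * v) : psiU ψ u = psiU ψ v := by
  rw [mul_monomialMatrix_eq_iff] at h
  rw [psiU_eq, psiU_eq, superdiagSum, superdiagSum]
  congr 1
  have hasc : ∀ i j : Fin n, (i : ℕ) + 1 = j → u i j ≠ 0 → (σ i : ℕ) + 1 = σ j ∧ a i = a j := by
    intro i j hij hne
    refine h1 i j hij ?_
    by_contra! hle
    have hlt : σ j < σ i := lt_of_le_of_ne hle fun e => by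
      rw [σ.injective e] at hij; omega
    have := h i j
    rw [hv.2 _ _ hlt, mul_zero] at this
    exact (mul_ne_zero hne (ha j)) this
  refine Finset.sum_bij_ne_zero (fun x _ _ => (σ x.1, σ x.2)) ?_ ?_ ?_ ?_
  · rintro ⟨i, j⟩ hx hne
    simp only [Finset.mem_filter, Finset.mem_univ, true_and] at hx ⊢
    exact (hasc i j hx hne).1
  · rintro ⟨i, j⟩ _ _ ⟨i', j'⟩ _ _ he
    simpa using he
  · rintro ⟨l, m⟩ hx hne
    obtain ⟨i, rfl⟩ := σ.surjective l
    obtain ⟨j, rfl⟩ := σ.surjective m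
    simp only [Finset.mem_filter, Finset.mem_univ, true_and] at hx hne
    have hu0 : u i j ≠ 0 := fun e => by
      have := h i j
      rw [e, zero_mul] at this
      exact mul_ne_zero (ha i) hne this.symm
    have hij : i < j := by
      by_contra! hle
      have hlt : j < i := lt_of_le_of_ne hle fun e => by rw [e] at hx; omega
      exact hu0 (hu.2 _ _ hlt)
    exact ⟨(i, j), by simpa using h2 i j hij hx, hu0, rfl⟩
  · rintro ⟨i, j⟩ hx hne
    simp only [Finset.mem_filter, Finset.mem_univ, true_and] at hx
    have := h i j
    rw [← (hasc i j hx hne).2, mul_comm] at this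
    exact mul_left_cancel₀ (ha i) this

lemma exists_psiU_ne_of_ascent {ψ : AddChar F ℂ} (hψ : ψ ≠ 1) {σ : Equiv.Perm (Fin n)}
    {a : Fin n → F} (ha : ∀ i, a i ≠ 0) {i j : Fin n} (hij : (i : ℕ) + 1 = j)
    (hσ : σ i < σ j) (hbad : ¬ ((σ i : ℕ) + 1 = σ j ∧ a i = a j)) :
    ∃ u v : Matrix (Fin n) (Fin n) F, IsUnipUpper u ∧ IsUnipUpper v ∧
      u * monomialMatrix σ a = monomialMatrix σ a * v ∧ psiU ψ u ≠ psiU ψ v := by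
  obtain ⟨y, hy⟩ : ∃ y, ψ y ≠ 1 := by
    by_contra! h
    exact hψ (DFunLike.ext _ _ h)
  have hij' : i < j := by rw [Fin.lt_def]; omega
  have hcomm : ∀ x, Matrix.transvection i j x * monomialMatrix σ a =
      monomialMatrix σ a * Matrix.transvection (σ i) (σ j) (x * a j / a i) := by
    intro x
    rw [mul_monomialMatrix_eq_iff]
    intro k l
    simp only [Matrix.transvection, Matrix.add_apply, Matrix.one_apply, Matrix.single_apply,
      σ.injective.eq_iff, add_mul, mul_add]
    congr 1
    · by_cases hkl : k = l
      · simp [hkl]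
      · simp [hkl]
    · by_cases h : i = k ∧ j = l
      · obtain ⟨rfl, rfl⟩ := h
        have := ha i
        simp
        field_simp
      · simp [h]
  have key : ∃ x, ψ x ≠ ψ (if (σ i : ℕ) + 1 = σ j then x * a j / a i else 0) := by
    by_cases hs : (σ i : ℕ) + 1 = σ j
    · have hne : a i ≠ a j := fun e => hbad ⟨hs, e⟩
      have hai := ha i
      have hsub : a i - a j ≠ 0 := sub_ne_zero.mpr hne
      refine ⟨y * a i / (a i - a j), fun e => hy ?_⟩
      rw [if_pos hs] at e
      have hdecomp : y * a i / (a i - a j) = y + y * a i / (a i - a j) * a j / a i := by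
        field_simp
        ring
      rw [hdecomp, AddChar.map_add_eq_mul, ← hdecomp] at e
      exact mul_eq_right₀ (AddChar.val_isUnit ψ _).ne_zero |>.mp e
    · exact ⟨y, by rw [if_neg hs, AddChar.map_zero_eq_one]; exact hy⟩
  obtain ⟨x, hx⟩ := key
  refine ⟨_, _, isUnipUpper_transvection hij' x, isUnipUpper_transvection hσ _, hcomm x, ?_⟩
  rw [psiU_eq, psiU_eq, superdiagSum_transvection, superdiagSum_transvection, if_pos hij]
  exact hx

/-- Elimination of the column `k` and of the row of its lowest nonzero entry by unitriangular
row and column operations. -/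
lemma exists_clear_column {g : Matrix (Fin n) (Fin n) F} (hg : IsUnit g) {k : Fin n}
    (hk : ∀ c < k, ∃ r, g r c ≠ 0 ∧ (∀ x, x ≠ r → g x c = 0) ∧ ∀ y, y ≠ c → g r y = 0) :
    ∃ u v : Matrix (Fin n) (Fin n) F, IsUnipUpper u ∧ IsUnipUpper v ∧
      ∀ c ≤ k, ∃ r, (u * g * v) r c ≠ 0 ∧
      (∀ x, x ≠ r → (u * g * v) x c = 0) ∧ ∀ y, y ≠ c → (u * g * v) r y = 0 := by
  classical
  have hcol : ∃ i, g i k ≠ 0 := by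
    by_contra! h
    have h1 : g.mulVec (Pi.single k 1) = 0 := by ext i; simp [h]
    have h2 := Matrix.mulVec_injective_iff_isUnit.mpr hg (h1.trans (Matrix.mulVec_zero g).symm)
    have := congrFun h2 k
    simp at this
  obtain ⟨i, hi, hmax⟩ : ∃ i, g i k ≠ 0 ∧ ∀ x, i < x → g x k = 0 := by
    let s := Finset.univ.filter fun i => g i k ≠ 0
    have hs : s.Nonempty := hcol.imp fun i hi => by simpa [s] using hi
    refine ⟨s.max' hs, by simpa [s] using s.max'_mem hs, fun x hx => ?_⟩
    by_contra h
    exact absurd (s.le_max' x (by simpa [s] using h)) (not_le.mpr hx)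
  have hrow : ∀ c < k, g i c = 0 := by
    intro c hc
    obtain ⟨r, h1, h2, h3⟩ := hk c hc
    refine h2 i fun e => hi ?_
    rw [e]
    exact h3 k hc.ne'
  let p : Fin n → F := fun x => if x = i then 0 else - g x k / g i k
  let q : Fin n → F := fun y => if y = k then 0 else - g i y / g i k
  let u : Matrix (Fin n) (Fin n) F := 1 + Matrix.vecMulVec p (Pi.single i 1)
  let v : Matrix (Fin n) (Fin n) F := 1 + Matrix.vecMulVec (Pi.single k 1) q
  have hug : ∀ x y, (u * g) x y = g x y + p x * g i y := by
    intro x y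
    simp [u, add_mul, Matrix.vecMulVec_mul, Matrix.vecMulVec_apply]
  have hugv : ∀ x y, (u * g * v) x y = (u * g) x y + (u * g) x k * q y := by
    intro x y
    simp only [v, mul_add, mul_one, Matrix.mul_vecMulVec, Matrix.vecMulVec_apply, Matrix.add_apply]
    simp
  have hpk : ∀ x, g x k = 0 → p x = 0 := fun x hx => by simp [p, hx]
  have hpi : p i = 0 := by simp [p]
  have hqk : q k = 0 := by simp [q]
  have hugk : ∀ x, x ≠ i → (u * g) x k = 0 := by
    intro x hx
    rw [hug]
    simp only [p, if_neg hx]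
    field_simp
    ring
  have hugi : ∀ y, (u * g) i y = g i y := fun y => by rw [hug, hpi]; ring
  refine ⟨u, v, ⟨fun x => ?_, fun x y hxy => ?_⟩, ⟨fun x => ?_, fun x y hxy => ?_⟩, fun c hc => ?_⟩
  · by_cases h : x = i
    · subst h; simp [u, Matrix.vecMulVec_apply, hpi]
    · simp [u, Matrix.vecMulVec_apply, h]
  · have hne : x ≠ y := fun e => by rw [e] at hxy; omega
    by_cases h : y = i
    · subst h; simp [u, Matrix.vecMulVec_apply, hne, hpk x (hmax x hxy)]
    · simp [u, Matrix.vecMulVec_apply, h, hne]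
  · by_cases h : x = k
    · subst h; simp [v, Matrix.vecMulVec_apply, hqk]
    · simp [v, Matrix.vecMulVec_apply, h]
  · have hne : x ≠ y := fun e => by rw [e] at hxy; omega
    by_cases h : x = k
    · subst h
      have : q y = 0 := by simp [q, hrow y hxy]
      simp [v, Matrix.vecMulVec_apply, hne, this]
    · simp [v, Matrix.vecMulVec_apply, h, hne]
  · rcases hc.lt_or_eq with hc | rfl
    · obtain ⟨r, h1, h2, h3⟩ := hk c hc
      have hqc : q c = 0 := by simp [q, hrow c hc]
      have hpr : p r = 0 := hpk r (h3 k hc.ne')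
      refine ⟨r, ?_, fun x hx => ?_, fun y hy => ?_⟩
      · rw [hugv, hug, hqc, hpr]
        simpa using h1
      · rw [hugv, hug, hqc, h2 x hx, hrow c hc]
        ring
      · rw [hugv, hug, hug, hpr, h3 y hy, h3 k hc.ne']
        ring
    · refine ⟨i, ?_, fun x hx => ?_, fun y hy => ?_⟩
      · rw [hugv, hugi, hqk]
        simpa using hi
      · rw [hugv, hugk x hx, hqk]
        ring
      · rw [hugv, hugi, hugi]
        simp only [q, if_neg hy]
        field_simp
        ring

/-- Bruhat decomposition. -/
lemma exists_monomialMatrix {g : Matrix (Fin n) (Fin n) F} (hg : IsUnit g) :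
    ∃ u v : Matrix (Fin n) (Fin n) F, IsUnipUpper u ∧ IsUnipUpper v ∧
      ∃ (σ : Equiv.Perm (Fin n)) (a : Fin n → F),
      (∀ i, a i ≠ 0) ∧ u * g * v = monomialMatrix σ a := by
  have hind : ∀ k ≤ n, ∃ u v : Matrix (Fin n) (Fin n) F, IsUnipUpper u ∧ IsUnipUpper v ∧
      ∀ c : Fin n, (c : ℕ) < k → ∃ r, (u * g * v) r c ≠ 0 ∧
      (∀ x, x ≠ r → (u * g * v) x c = 0) ∧ ∀ y, y ≠ c → (u * g * v) r y = 0 := by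
    intro k
    induction k with
    | zero => exact fun _ => ⟨1, 1, isUnipUpper_one, isUnipUpper_one, fun c hc => by omega⟩
    | succ k ih =>
      intro hk
      obtain ⟨u, v, hu, hv, h⟩ := ih (by omega)
      obtain ⟨u', v', hu', hv', h'⟩ := exists_clear_column (k := ⟨k, by omega⟩)
        ((hu.isUnit.mul hg).mul hv.isUnit) (fun c hc => h c hc)
      refine ⟨u' * u, v * v', hu'.mul hu, hv.mul hv', fun c hc => ?_⟩
      have he : u' * u * g * (v * v') = u' * (u * g * v) * v' := by simp only [mul_assoc]
      rw [he]
      exact h' c (Nat.lt_succ_iff.mp hc)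
  obtain ⟨u, v, hu, hv, h⟩ := hind n le_rfl
  choose r h1 h2 h3 using fun c : Fin n => h c c.isLt
  have hinj : Function.Injective r := by
    intro c c' hcc
    by_contra hne
    exact h1 c' (by rw [← hcc]; exact h3 c c' (Ne.symm hne))
  let ρ : Equiv.Perm (Fin n) := Equiv.ofBijective r (Finite.injective_iff_bijective.mp hinj)
  have hρ : ∀ i, r (ρ.symm i) = i := ρ.apply_symm_apply
  refine ⟨u, v, hu, hv, ρ.symm, fun i => (u * g * v) i (ρ.symm i), fun i => ?_, ?_⟩
  · have := h1 (ρ.symm i)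
    rwa [hρ] at this
  · ext i j
    rw [monomialMatrix]
    split_ifs with hij
    · rw [hij]
    · have := h3 (ρ.symm i) j (Ne.symm hij)
      rwa [hρ] at this

end Bruhat

section Whittaker

variable {F : Type} [Field F] {n : ℕ}

/-- Extension of `c` to all of `ℕ` by the value `1`. -/
def extendOne (c : Fin n → F) (j : ℕ) : F := if h : j < n then c ⟨j, h⟩ else 1

lemma extendOne_of_lt (c : Fin n → F) {j : ℕ} (h : j < n) : extendOne c j = c ⟨j, h⟩ :=
  dif_pos h

lemma extendOne_ne_zero_of_le (c : Fin n → F) (j : ℕ) (h : n ≤ j) : extendOne c j ≠ 0 := by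
  rw [extendOne, dif_neg (by omega)]
  exact one_ne_zero

variable (F n) in
/-- Parameters of the relevant double cosets: the nonzero entries mark the starts of the blocks,
with their values. -/
abbrev BlockData : Type := {c : Fin n → F // extendOne c 0 ≠ 0}

/-- The block starts of `c`. -/
def BlockData.IsStart (c : BlockData F n) (j : ℕ) : Prop := extendOne c.1 j ≠ 0

lemma BlockData.isStart_zero (c : BlockData F n) : c.IsStart 0 := c.2

lemma BlockData.isStart_of_le (c : BlockData F n) (j : ℕ) (h : n ≤ j) : c.IsStart j :=
  extendOne_ne_zero_of_le c.1 j h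

/-- The block antidiagonal permutation: all blocks are reversed, then everything is reversed. -/
noncomputable def BlockData.perm (c : BlockData F n) : Equiv.Perm (Fin n) :=
  (Function.Involutive.toPerm
    (fun i : Fin n => (⟨blockReverse c.IsStart i,
      blockReverse_lt c.isStart_zero c.isStart_of_le i.isLt⟩ : Fin n))
    fun _ => Fin.ext (involutive_blockReverse c.isStart_zero c.isStart_of_le _)).trans Fin.revPerm

lemma BlockData.perm_add (c : BlockData F n) (i : Fin n) :
    (c.perm i : ℕ) + blockReverse c.IsStart i + 1 = n := by
  have h := blockReverse_lt c.isStart_zero c.isStart_of_le i.isLt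
  have h1 : (c.perm i : ℕ) = n - (blockReverse c.IsStart i + 1) := rfl
  omega

/-- The entries, constant on each block. -/
noncomputable def BlockData.entry (c : BlockData F n) (i : Fin n) : F :=
  extendOne c.1 (blockStart c.IsStart i)

lemma BlockData.entry_ne_zero (c : BlockData F n) (i : Fin n) : c.entry i ≠ 0 :=
  (isBlock_blockStart_blockEnd c.isStart_zero c.isStart_of_le i).2.2.1

/-- The representative of the relevant double coset with parameter `c`. -/
noncomputable def BlockData.toGL (c : BlockData F n) : (Matrix (Fin n) (Fin n) F)ˣ :=
  (isUnit_monomialMatrix c.perm c.entry_ne_zero).unit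

lemma BlockData.ext_of_perm_entry {c c' : BlockData F n} (hperm : c.perm = c'.perm)
    (hentry : c.entry = c'.entry) : c = c' := by
  have hrev : ∀ j < n, blockReverse c.IsStart j = blockReverse c'.IsStart j := by
    intro j hj
    have h := c.perm_add ⟨j, hj⟩
    have h' := c'.perm_add ⟨j, hj⟩
    rw [hperm] at h
    simp only at h h'
    omega
  refine Subtype.ext (funext fun i => ?_)
  have hstart : c.IsStart i ↔ c'.IsStart i := by
    rw [start_iff_blockReverse_lt c.isStart_zero c.isStart_of_le,
      start_iff_blockReverse_lt c'.isStart_zero c'.isStart_of_le, hrev _ i.isLt,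
      hrev (i - 1) (by omega)]
  have hval : ∀ b : BlockData F n, extendOne b.1 i = b.1 i := fun b => extendOne_of_lt b.1 i.isLt
  by_cases h : c.IsStart i
  · have he := congrFun hentry i
    rwa [BlockData.entry, BlockData.entry,
      blockStart_eq_self c.isStart_zero c.isStart_of_le h,
      blockStart_eq_self c'.isStart_zero c'.isStart_of_le (hstart.mp h), hval, hval] at he
  · have h' := mt hstart.mpr h
    rw [BlockData.IsStart, not_ne_iff, hval] at h h'
    rw [h, h']

lemma antiTranspose_monomialMatrix_blockData (c : BlockData F n) :
    antiTranspose (monomialMatrix c.perm c.entry) = monomialMatrix c.perm c.entry := by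
  have hkey : ∀ i j : Fin n, c.perm j.rev = i.rev → c.perm i = j ∧ c.entry j.rev = c.entry i := by
    intro i j h
    have h1 := c.perm_add j.rev
    have h2 := c.perm_add i
    have h3 : blockReverse c.IsStart j.rev = i := by
      rw [h, Fin.val_rev] at h1
      omega
    have h4 : blockReverse c.IsStart i = j.rev := by
      rw [← h3, involutive_blockReverse c.isStart_zero c.isStart_of_le]
    refine ⟨Fin.ext ?_, ?_⟩
    · rw [h4, Fin.val_rev] at h2
      omega
    · rw [BlockData.entry, BlockData.entry, ← h4,
        blockStart_blockReverse c.isStart_zero c.isStart_of_le]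
  ext i j
  rw [antiTranspose, monomialMatrix, monomialMatrix]
  by_cases h : c.perm j.rev = i.rev
  · rw [if_pos h, if_pos (hkey i j h).1, (hkey i j h).2]
  · rw [if_neg h, if_neg]
    intro h'
    refine h (hkey j.rev i.rev ?_).1
    rw [Fin.rev_rev, Fin.rev_rev, h']

lemma BlockData.perm_step (c : BlockData F n) {i j : Fin n} (hij : (i : ℕ) + 1 = j)
    (h : c.perm i < c.perm j) : (c.perm i : ℕ) + 1 = c.perm j ∧ c.entry i = c.entry j := by
  have h1 := c.perm_add i
  have h2 := c.perm_add j
  rw [Fin.lt_def] at h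
  rw [← hij] at h2
  have h3 := blockReverse_step c.isStart_zero c.isStart_of_le (j := i) (by omega)
  exact ⟨by omega, by rw [BlockData.entry, BlockData.entry, ← hij, h3.2]⟩

lemma BlockData.consecutive_of_perm (c : BlockData F n) {i j : Fin n} (hij : i < j)
    (h : (c.perm i : ℕ) + 1 = c.perm j) : (i : ℕ) + 1 = j := by
  have h1 := c.perm_add i
  have h2 := c.perm_add j
  rw [Fin.lt_def] at hij
  have hj : (i : ℕ) + (j - i) = j := by omega
  have h3 := apply_add_of_inversion
    (involutive_blockReverse c.isStart_zero c.isStart_of_le).injective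
    (fun j h => (blockReverse_step c.isStart_zero c.isStart_of_le h).1) (j - i) i
    (by rw [hj]; omega) (j - i) le_rfl
  rw [hj] at h3
  omega

lemma exists_blockData {σ : Equiv.Perm (Fin n)} {a : Fin n → F} (ha : ∀ i, a i ≠ 0)
    (h : ∀ i j : Fin n, (i : ℕ) + 1 = j → σ i < σ j → (σ i : ℕ) + 1 = σ j ∧ a i = a j) :
    ∃ c : BlockData F n, σ = c.perm ∧ a = c.entry := by
  classical
  let p : Equiv.Perm ℕ := Equiv.Perm.extendDomain (σ.trans Fin.revPerm) Fin.equivSubtype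
  have hp : ∀ i : Fin n, (σ i : ℕ) + p i + 1 = n := by
    intro i
    have h1 : p i = (σ i).rev :=
      Equiv.Perm.extendDomain_apply_image (σ.trans Fin.revPerm) Fin.equivSubtype i
    rw [h1, Fin.val_rev]
    have := (σ i).isLt
    omega
  have hp' : ∀ j, n ≤ j → p j = j := fun j hj =>
    Equiv.Perm.extendDomain_apply_not_subtype _ _ (by omega)
  have hstep : ∀ j (hj : j + 1 < n), p (j + 1) < p j →
      p (j + 1) + 1 = p j ∧ a ⟨j, by omega⟩ = a ⟨j + 1, hj⟩ := by
    intro j hj hlt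
    have h1 := hp ⟨j, by omega⟩
    have h2 := hp ⟨j + 1, hj⟩
    simp only at h1 h2
    have h3 := h ⟨j, by omega⟩ ⟨j + 1, hj⟩ rfl (by rw [Fin.lt_def]; omega)
    exact ⟨by omega, h3.2⟩
  have hasc : ∀ j, n ≤ j + 1 → p j < p (j + 1) := by
    intro j hj
    rw [hp' _ hj]
    rcases Nat.lt_or_ge j n with hlt | hge
    · have := hp ⟨j, hlt⟩
      simp only at this
      omega
    · rw [hp' _ hge]
      omega
  let c : Fin n → F := fun i => if (i : ℕ) = 0 ∨ p (i - 1) < p i then a i else 0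
  have hc0 : extendOne c 0 ≠ 0 := by
    rw [extendOne]
    split_ifs
    · simp [c, ha]
    · exact one_ne_zero
  let b : BlockData F n := ⟨c, hc0⟩
  have hD : ∀ j, b.IsStart (j + 1) ↔ p j < p (j + 1) := by
    intro j
    rcases Nat.lt_or_ge (j + 1) n with hj | hj
    · rw [BlockData.IsStart, extendOne_of_lt _ hj]
      simp [b, c, ha]
    · exact ⟨fun _ => hasc j hj, fun _ => b.isStart_of_le _ hj⟩
  have hrev : ∀ j, p j = blockReverse b.IsStart j :=
    eq_blockReverse_of_layered p (fun j hlt => (hstep j (by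
      by_contra! hj
      exact lt_asymm hlt (hasc j hj)) hlt).1) b.isStart_zero b.isStart_of_le hD
  refine ⟨b, Equiv.ext fun i => Fin.ext ?_, ?_⟩
  · have h1 := hp i
    have h2 := b.perm_add i
    rw [hrev] at h1
    omega
  · have hval : ∀ j (hj : j < n), a ⟨j, hj⟩ = extendOne c (blockStart b.IsStart j) := by
      intro j
      induction j with
      | zero =>
        intro hj
        rw [blockStart_eq_self b.isStart_zero b.isStart_of_le b.isStart_zero,
          extendOne_of_lt _ hj]
        simp [c]
      | succ j ih =>
        intro hj
        by_cases hs : b.IsStart (j + 1)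
        · rw [blockStart_eq_self b.isStart_zero b.isStart_of_le hs, extendOne_of_lt _ hj]
          have := (hD j).mp hs
          simp [c, this]
        · have hlt : p (j + 1) < p j := by
            refine lt_of_le_of_ne (not_lt.mp (mt (hD j).mpr hs)) fun e => ?_
            have := p.injective e
            omega
          rw [← (hstep j hj hlt).2, ih]
          rw [hrev, hrev] at hlt
          rw [(blockReverse_step b.isStart_zero b.isStart_of_le hlt).2]
    exact funext fun i => hval i i.isLt

lemma card_blockData [Fintype F] (hn : 1 ≤ n) :
    Nat.card (BlockData F n) = Fintype.card F ^ n - Fintype.card F ^ (n - 1) := by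
  classical
  obtain ⟨k, rfl⟩ : ∃ k, n = k + 1 := ⟨n - 1, by omega⟩
  let e : BlockData F (k + 1) ≃ {x : F // x ≠ 0} × (Fin k → F) :=
    { toFun c := (⟨c.1 0, c.2⟩, fun i => c.1 i.succ)
      invFun x := ⟨Fin.cons x.1.1 x.2, x.1.2⟩
      left_inv c := Subtype.ext (Fin.cons_self_tail c.1)
      right_inv x := by simp }
  rw [Nat.card_congr e, Nat.card_prod, Nat.card_eq_fintype_card, Nat.card_eq_fintype_card,
    Fintype.card_subtype_compl, Fintype.card_subtype_eq, Fintype.card_fun, Fintype.card_fin,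
    Nat.sub_mul, one_mul, pow_succ', Nat.add_sub_cancel]

variable [Finite F]

lemma exists_mul_toGL_mul_or (ψ : AddChar F ℂ) (hψ : ψ ≠ 1) (g : (Matrix (Fin n) (Fin n) F)ˣ) :
    (∃ c : BlockData F n, ∃ u v : unipSubgroup F n,
      (u : (Matrix (Fin n) (Fin n) F)ˣ) * c.toGL * v = g) ∨
      ∃ u v : unipSubgroup F n, (u : (Matrix (Fin n) (Fin n) F)ˣ) * g * v = g ∧
        unipChar ψ u * unipChar ψ v ≠ 1 := by
  have hlift : ∀ u : Matrix (Fin n) (Fin n) F, IsUnipUpper u →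
      ∃ w : unipSubgroup F n, ((w : (Matrix (Fin n) (Fin n) F)ˣ) : Matrix (Fin n) (Fin n) F) = u :=
    fun u hu => ⟨⟨hu.isUnit.unit, hu⟩, rfl⟩
  obtain ⟨u₀, v₀, hu, hv, σ, a, ha, hg⟩ := exists_monomialMatrix g.isUnit
  obtain ⟨u, rfl⟩ := hlift _ hu
  obtain ⟨v, rfl⟩ := hlift _ hv
  by_cases h : ∀ i j : Fin n, (i : ℕ) + 1 = j → σ i < σ j → (σ i : ℕ) + 1 = σ j ∧ a i = a j
  · obtain ⟨c, rfl, rfl⟩ := exists_blockData ha h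
    refine Or.inl ⟨c, u⁻¹, v⁻¹, ?_⟩
    have hg' : u.1 * g * v.1 = c.toGL := Units.ext hg
    rw [← hg']
    simp [mul_assoc]
  · push Not at h
    obtain ⟨i, j, hij, hlt, hbad⟩ := h
    obtain ⟨x, y, hx, hy, hxy, hne⟩ := exists_psiU_ne_of_ascent hψ ha hij hlt
      (fun e => hbad e.1 e.2)
    obtain ⟨x, rfl⟩ := hlift _ hx
    obtain ⟨y, rfl⟩ := hlift _ hy
    have hxy' : x.1 * (u.1 * g * v.1) = (u.1 * g * v.1) * y.1 := by
      refine Units.ext ?_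
      rw [← hg] at hxy
      exact hxy
    refine Or.inr ⟨u⁻¹ * x * u, v * y⁻¹ * v⁻¹, ?_, ?_⟩
    · calc ((u⁻¹ * x * u : unipSubgroup F n) : (Matrix (Fin n) (Fin n) F)ˣ) * g *
          ((v * y⁻¹ * v⁻¹ : unipSubgroup F n) : (Matrix (Fin n) (Fin n) F)ˣ)
          = u.1⁻¹ * (x.1 * (u.1 * g * v.1)) * y.1⁻¹ * v.1⁻¹ := by
            simp only [Subgroup.coe_mul, Subgroup.coe_inv, mul_assoc]
        _ = g := by
          rw [hxy']
          group
    · intro h1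
      refine hne ?_
      have h2 : unipChar ψ x * unipChar ψ y⁻¹ = 1 := by
        rw [← h1]
        simp only [map_mul]
        linear_combination (-(unipChar ψ x * unipChar ψ y⁻¹)) *
          (char_inv_mul_self (χ := unipChar ψ) u +
            unipChar ψ u⁻¹ * unipChar ψ u * char_mul_inv_self (χ := unipChar ψ) v)
      calc unipChar ψ x = unipChar ψ x * (unipChar ψ y⁻¹ * unipChar ψ y) := by
            rw [char_inv_mul_self, mul_one]
        _ = unipChar ψ y := by rw [← mul_assoc, h2, one_mul]

end Whittaker

/-- the number of isomorphism classes of irreducible generic representations of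
`GL_n(F)` equals `q^n - q^{n-1}`: there is a finite complete system of pairwise
non-isomorphic representatives of cardinality `q^n - q^{n-1}`. -/
theorem card_generic_iso_classes
    (F : Type) [Field F] [Fintype F] [DecidableEq F]
    (ψ : AddChar F ℂ) (hψ : ψ ≠ 1)
    (n : ℕ) (hn : 1 ≤ n) :
    ∃ (ι : Type) (_ : Fintype ι) (σ : ι → FinRep n F),
      (∀ i, (σ i).Irreducible ∧ (σ i).Generic ψ) ∧
      (∀ i j, (σ i).Iso (σ j) → i = j) ∧
      (∀ τ : FinRep n F, τ.Irreducible → τ.Generic ψ → ∃ i, τ.Iso (σ i)) ∧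
      Nat.card ι = Fintype.card F ^ n - Fintype.card F ^ (n - 1) := by
  let m : BlockData F n → (Matrix (Fin n) (Fin n) F)ˣ := BlockData.toGL
  have hcover := exists_mul_toGL_mul_or (n := n) ψ hψ
  have hmono : ∀ c c' : BlockData F n, ∀ u v : unipSubgroup F n,
      (u : (Matrix (Fin n) (Fin n) F)ˣ) * m c * v = m c' →
        ((u : (Matrix (Fin n) (Fin n) F)ˣ) : Matrix (Fin n) (Fin n) F) *
          monomialMatrix c.perm c.entry = monomialMatrix c'.perm c'.entry *
            ((v⁻¹ : unipSubgroup F n) : (Matrix (Fin n) (Fin n) F)ˣ) := fun c c' u v h =>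
    congrArg Units.val (eq_mul_inv_of_mul_eq h)
  have hdisj : ∀ c c' : BlockData F n, ∀ u v : unipSubgroup F n,
      (u : (Matrix (Fin n) (Fin n) F)ˣ) * m c * v = m c' → c = c' := by
    intro c c' u v h
    obtain ⟨h1, h2⟩ := monomialMatrix_unique u.2 (v⁻¹).2 c.entry_ne_zero (hmono c c' u v h)
    exact BlockData.ext_of_perm_entry h1 h2
  have hgood : ∀ c : BlockData F n, ∀ u v : unipSubgroup F n,
      (u : (Matrix (Fin n) (Fin n) F)ˣ) * m c * v = m c →
        unipChar ψ u * unipChar ψ v = 1 := by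
    intro c u v h
    have h1 : unipChar ψ u = unipChar ψ v⁻¹ :=
      psiU_eq_of_mul_monomialMatrix u.2 (v⁻¹).2 ψ c.entry_ne_zero (fun _ _ => c.perm_step)
        (fun _ _ => c.consecutive_of_perm) (hmono c c u v h)
    rw [h1, char_inv_mul_self]
  have hcomm := commute_of_antiAutomorphism m hcover antiTransposeHom unipAntiTranspose
    (fun _ => rfl) (fun u => ?_)
    fun c => MulOpposite.unop_injective (Units.ext (antiTranspose_monomialMatrix_blockData c))
  · obtain ⟨ι, hι, σ, h1, h2, h3, h4⟩ :=
      exists_generic_representatives (ψ := ψ) (fun _ => Iff.rfl) (fun _ => rfl) hcomm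
    refine ⟨ι, hι, σ, h1, h2, h3, ?_⟩
    have : Fintype (BlockData F n) := Fintype.ofFinite _
    rw [h4, ← span_heckeElement m hcover,
      finrank_span_eq_card (linearIndependent_heckeElement m hdisj hgood),
      ← Nat.card_eq_fintype_card, card_blockData hn]
  · have h := unipChar_unipAntiTranspose ψ u
    have h1 := char_inv_mul_self (χ := unipChar ψ) u
    have h2 := char_mul_inv_self (χ := unipChar ψ) (unipAntiTranspose u)
    rw [h] at h2
    calc unipChar ψ (unipAntiTranspose u)⁻¹
        = unipChar ψ u⁻¹ * unipChar ψ u * unipChar ψ (unipAntiTranspose u)⁻¹ := by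
          rw [h1, one_mul]
      _ = unipChar ψ u⁻¹ := by rw [mul_assoc, h2, mul_one]
end
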